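/- There are D, ε*>0 such that the following holds. Let 𝒢=(U,V;E) be an irreducible bigraph. For all 0<ε₁<min{|V|^{-D},(ε*)^{D}} there is ε₂*:ℕ→(0,1) such that for all t≥1 and all ε₂:ℕ→(0,1) with ε₂(x)<ε₂*(x) for all x, there is ε>0 such that for all sufficiently large n the following holds. Suppose Γ=(A∪B,(P_u)_{u∈U}) is a bipartite U-colored graph with |A|=|B|=n such that for each u∈U, (A∪B,P_u) is ε-regular with density 1/|U| ± ε. Suppose H is an (n/|V|,Γ)-blowup of 𝒢, with vertex set A∪B∪C where C=⋃_{v∈V}C_v, each |C_v|=n/|V|, and E(H)∩K₃[A,B,C] = ⋃_{(u,v)∈E}{ {x,y,z} : {x,y}∈P_u, z∈C_v }. Suppose 𝒫 is a dev_{2,3}(ε₁^D,ε₂(ℓ)^D)-regular (3t,ℓ,ε₁^D,ε₂(ℓ)^D)-decomposition of H whose vertex partition 𝒫₁={A_i,B_i,W_i : i∈[t]} refines {A,B,C} (A=⋃A_i, B=⋃B_i, C=⋃W_i), with pair partitions 𝒫₂={P^α_{A_iB_j}, P^β_{A_iW_k}, P^γ_{B_jW_k}}. Then there are A_i,B_j∈𝒫₁,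 a set 𝒵⊆[ℓ], and for each α∈𝒵 a set 𝒞_α⊆{C_v : v∈V}, such that: (1) |A_i| ≥ ε₁^D|A|/3t and |B_j| ≥ ε₁^D|B|/3t; (2) |⋃_{α∈𝒵}P^α_{A_iB_j}| ≥ (1−ε₁^{D/4})|A_i||B_j|; (3) for all α∈𝒵, |𝒞_α| ≥ (1−3ε₁^{D/8})|V|; (4) for all α∈𝒵 and C_v∈𝒞_α there is f(α,v)∈{0,1} such that |P^α_{A_iB_j} ∩ ⋂_{C_v∈𝒞_α} (⋃_{u∈N^{f(α,v)}_𝒢(v)} P̄_u)| ≥ (1−ε₁^{1/32})|P^α_{A_iB_j}|, where N¹_𝒢(v)={u∈U : (u,v)∈E}, N⁰_𝒢(v)=U∖N¹_𝒢(v), and P̄_u denotes the set of ordered pairs (x,y)∈A×B with {x,y}∈P_u. -/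

import Mathlib

open scoped Classical
open Finset

set_option maxHeartbeats 1000000

/-- A 3-uniform hypergraph on a finite vertex set of naturals. -/
structure ThreeGraph where
  verts : Finset ℕ
  edges : Finset (Finset ℕ)
  edges_sub : ∀ e ∈ edges, e ⊆ verts ∧ e.card = 3

/-- The set `Ē` of ordered triples corresponding to edges. -/
def ThreeGraph.obar (H : ThreeGraph) : Finset (ℕ × ℕ × ℕ) :=
  (H.verts ×ˢ H.verts ×ˢ H.verts).filter fun p => ({p.1, p.2.1, p.2.2} : Finset ℕ) ∈ H.edges

/-- A bigraph `(U,V;E)`. -/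
structure Bigraph where
  left : Finset ℕ
  right : Finset ℕ
  edges : Finset (ℕ × ℕ)
  edges_sub : edges ⊆ left ×ˢ right

noncomputable def Bigraph.density (B : Bigraph) : ℝ :=
  (B.edges.card : ℝ) / ((B.left.card : ℝ) * (B.right.card : ℝ))

noncomputable def Bigraph.gfun (B : Bigraph) (u w : ℕ) : ℝ :=
  if (u, w) ∈ B.edges then 1 - B.density else -B.density

noncomputable def Bigraph.devSum (B : Bigraph) : ℝ :=
  ∑ u₀ ∈ B.left, ∑ u₁ ∈ B.left, ∑ w₀ ∈ B.right, ∑ w₁ ∈ B.right,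
    B.gfun u₀ w₀ * B.gfun u₀ w₁ * B.gfun u₁ w₀ * B.gfun u₁ w₁

/-- `B` has `dev₂(ε,d)`. -/
def Bigraph.dev2 (B : Bigraph) (ε d : ℝ) : Prop :=
  |B.density - d| ≤ ε ∧ B.devSum ≤ ε * (B.left.card : ℝ) ^ 2 * (B.right.card : ℝ) ^ 2

/-- `B` has `dev₂(ε)`, i.e. `dev₂(ε, d_B)`. -/
def Bigraph.dev2self (B : Bigraph) (ε : ℝ) : Prop := B.dev2 ε B.density

noncomputable def Bigraph.dBetween (B : Bigraph) (X Y : Finset ℕ) : ℝ :=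
  ((B.edges ∩ X ×ˢ Y).card : ℝ) / ((X.card : ℝ) * (Y.card : ℝ))

/-- `ε`-regularity for a bigraph. -/
def Bigraph.EpsRegular (B : Bigraph) (ε : ℝ) : Prop :=
  ∀ X ⊆ B.left, ∀ Y ⊆ B.right,
    ε * (B.left.card : ℝ) ≤ (X.card : ℝ) → ε * (B.right.card : ℝ) ≤ (Y.card : ℝ) →
      |B.density - B.dBetween X Y| ≤ ε

/-- Irreducibility: distinct vertices have distinct neighborhoods, on both sides. -/
def Bigraph.Irreducible (B : Bigraph) : Prop :=
  (∀ u ∈ B.left, ∀ u' ∈ B.left, (∀ v : ℕ, (u, v) ∈ B.edges ↔ (u', v) ∈ B.edges) → u = u') ∧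
  (∀ v ∈ B.right, ∀ v' ∈ B.right, (∀ u : ℕ, (u, v) ∈ B.edges ↔ (u, v') ∈ B.edges) → v = v')

def Bigraph.leftNbhd (B : Bigraph) (v : ℕ) : Finset ℕ :=
  B.left.filter fun u => (u, v) ∈ B.edges

/-- `B` contains an induced copy of the abstract bigraph on `Fin k × Fin k` given by `F`. -/
def Bigraph.HasInducedPattern (B : Bigraph) (k : ℕ) (F : Fin k → Fin k → Prop) : Prop :=
  ∃ u v : Fin k → ℕ, (∀ a, u a ∈ B.left) ∧ (∀ b, v b ∈ B.right) ∧
    ∀ a b, ((u a, v b) ∈ B.edges ↔ F a b)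

/-- A triad `(X,Y,Z; E_XY, E_YZ, E_XZ)`. -/
structure Triad where
  X : Finset ℕ
  Y : Finset ℕ
  Z : Finset ℕ
  EXY : Finset (ℕ × ℕ)
  EYZ : Finset (ℕ × ℕ)
  EXZ : Finset (ℕ × ℕ)
  hXY : EXY ⊆ X ×ˢ Y
  hYZ : EYZ ⊆ Y ×ˢ Z
  hXZ : EXZ ⊆ X ×ˢ Z

def Triad.K3 (G : Triad) : Finset (ℕ × ℕ × ℕ) :=
  (G.X ×ˢ G.Y ×ˢ G.Z).filter fun p =>
    (p.1, p.2.1) ∈ G.EXY ∧ (p.2.1, p.2.2) ∈ G.EYZ ∧ (p.1, p.2.2) ∈ G.EXZ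

def Triad.bXY (G : Triad) : Bigraph := ⟨G.X, G.Y, G.EXY, G.hXY⟩
def Triad.bYZ (G : Triad) : Bigraph := ⟨G.Y, G.Z, G.EYZ, G.hYZ⟩
def Triad.bXZ (G : Triad) : Bigraph := ⟨G.X, G.Z, G.EXZ, G.hXZ⟩

/-- `d_H(G)` where the (tri)graph is given by its set `R` of ordered triples. -/
noncomputable def relDensity (R : Finset (ℕ × ℕ × ℕ)) (G : Triad) : ℝ :=
  ((R ∩ G.K3).card : ℝ) / (G.K3.card : ℝ)

noncomputable def hFun (R : Finset (ℕ × ℕ × ℕ)) (G : Triad) (x y z : ℕ) : ℝ :=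
  if (x, y, z) ∈ G.K3 then
    (if (x, y, z) ∈ R then 1 - relDensity R G else -(relDensity R G))
  else 0

noncomputable def devSum3 (R : Finset (ℕ × ℕ × ℕ)) (G : Triad) : ℝ :=
  ∑ u₀ ∈ G.X, ∑ u₁ ∈ G.X, ∑ w₀ ∈ G.Y, ∑ w₁ ∈ G.Y, ∑ z₀ ∈ G.Z, ∑ z₁ ∈ G.Z,
    hFun R G u₀ w₀ z₀ * hFun R G u₀ w₀ z₁ * hFun R G u₀ w₁ z₀ * hFun R G u₀ w₁ z₁ *
      hFun R G u₁ w₀ z₀ * hFun R G u₁ w₀ z₁ * hFun R G u₁ w₁ z₀ * hFun R G u₁ w₁ z₁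

/-- `(H,G)` has `dev_{2,3}(ε₁,ε₂)`, where the trigraph/3-graph is given by triples `R`. -/
def dev23 (R : Finset (ℕ × ℕ × ℕ)) (G : Triad) (ε₁ ε₂ : ℝ) : Prop :=
  ∃ dXY dYZ dXZ : ℝ, 0 < dXY ∧ 0 < dYZ ∧ 0 < dXZ ∧
    G.bXY.dev2 ε₂ dXY ∧ G.bXZ.dev2 ε₂ dXZ ∧ G.bYZ.dev2 ε₂ dYZ ∧
    devSum3 R G ≤ ε₁ * dXY ^ 4 * dYZ ^ 4 * dXZ ^ 4 *
      (G.X.card : ℝ) ^ 2 * (G.Y.card : ℝ) ^ 2 * (G.Z.card : ℝ) ^ 2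

/-- `G` is `μ`-homogeneous with respect to the triples `R`: `d_H(G) ∈ [0,μ) ∪ (1-μ,1]`. -/
def homTriad (R : Finset (ℕ × ℕ × ℕ)) (G : Triad) (μ : ℝ) : Prop :=
  relDensity R G < μ ∨ 1 - μ < relDensity R G

/-- A `(t,ℓ)`-decomposition of `V`, with part-indices `ι` and pair-indices `κ`. -/
structure Decomp (V : Finset ℕ) (ι κ : Type) where
  part : ι → Finset ℕ
  part_sub : ∀ i, part i ⊆ V
  part_disj : ∀ i j, i ≠ j → Disjoint (part i) (part j)
  part_cover : ∀ x ∈ V, ∃ i, x ∈ part i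
  pairs : ι → ι → κ → Finset (ℕ × ℕ)
  pairs_sub : ∀ i j α, pairs i j α ⊆ part i ×ˢ part j
  pairs_disj : ∀ i j α β, α ≠ β → Disjoint (pairs i j α) (pairs i j β)
  pairs_cover : ∀ i j, ∀ p ∈ part i ×ˢ part j, ∃ α, p ∈ pairs i j α

def Decomp.pairBG {V : Finset ℕ} {ι κ : Type} (P : Decomp V ι κ) (i j : ι) (α : κ) : Bigraph :=
  ⟨P.part i, P.part j, P.pairs i j α, P.pairs_sub i j α⟩

/-- The triad `G^{ijk}_{α,β,γ} = (V_i,V_j,V_k; P^α_{ij}, P^β_{ik}, P^γ_{jk})`. -/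
def Decomp.triadOf {V : Finset ℕ} {ι κ : Type} (P : Decomp V ι κ) (i j k : ι) (α β γ : κ) :
    Triad :=
  ⟨P.part i, P.part j, P.part k, P.pairs i j α, P.pairs j k γ, P.pairs i k β,
    P.pairs_sub i j α, P.pairs_sub j k γ, P.pairs_sub i k β⟩

/-- `P` is a `(t,ℓ,ε₁,ε₂)`-decomposition. -/
def Decomp.isReg {V : Finset ℕ} {ι κ : Type} (P : Decomp V ι κ) (ε₁ ε₂ : ℝ) : Prop :=
  (1 - ε₁) * (V.card : ℝ) ^ 2 ≤
    (((V ×ˢ V).filter fun p =>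
      ∃ i j α, p ∈ P.pairs i j α ∧ (P.pairBG i j α).dev2self ε₂).card : ℝ)

/-- `P` is equitable. -/
def Decomp.isEquitable {V : Finset ℕ} {ι κ : Type} [Fintype κ]
    (P : Decomp V ι κ) (ε₁ ε₂ : ℝ) : Prop :=
  (∀ i j, (P.part i).card ≤ (P.part j).card + 1) ∧
  (1 - ε₁) * (V.card : ℝ) ^ 2 ≤
    (((V ×ˢ V).filter fun p =>
      ∃ i j α, p ∈ P.pairs i j α ∧
        (P.pairBG i j α).dev2 ε₂ (1 / (Fintype.card κ : ℝ))).card : ℝ)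

/-- `P` is `dev_{2,3}(ε₁,ε₂)`-regular with respect to the triples `R`. -/
def Decomp.regWrt {V : Finset ℕ} {ι κ : Type} (P : Decomp V ι κ)
    (R : Finset (ℕ × ℕ × ℕ)) (ε₁ ε₂ : ℝ) : Prop :=
  (1 - ε₁) * (V.card : ℝ) ^ 3 ≤
    (((V ×ˢ V ×ˢ V).filter fun p =>
      ∃ i j k α β γ, p ∈ (P.triadOf i j k α β γ).K3 ∧
        dev23 R (P.triadOf i j k α β γ) ε₁ ε₂).card : ℝ)

/-- The triad `G^{ijk}_{α,β,γ}` of `P` is `μ`-non-trivial. -/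
def Decomp.nonTrivTriad {V : Finset ℕ} {t ℓ : ℕ} (P : Decomp V (Fin t) (Fin ℓ)) (μ : ℝ)
    (i j k : Fin t) (α β γ : Fin ℓ) : Prop :=
  μ * (V.card : ℝ) / (t : ℝ) ≤ ((P.part i).card : ℝ) ∧
  μ * (V.card : ℝ) / (t : ℝ) ≤ ((P.part j).card : ℝ) ∧
  μ * (V.card : ℝ) / (t : ℝ) ≤ ((P.part k).card : ℝ) ∧
  μ * ((P.part i).card : ℝ) * ((P.part j).card : ℝ) / (ℓ : ℝ) ≤ ((P.pairs i j α).card : ℝ) ∧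
  μ * ((P.part i).card : ℝ) * ((P.part k).card : ℝ) / (ℓ : ℝ) ≤ ((P.pairs i k β).card : ℝ) ∧
  μ * ((P.part j).card : ℝ) * ((P.part k).card : ℝ) / (ℓ : ℝ) ≤ ((P.pairs j k γ).card : ℝ)

/-- `H` has a `dev_{2,3}(ε₁,ε₂)`-regular `(t,ℓ,ε₁,ε₂)`-decomposition. -/
def GoodDecomp (H : ThreeGraph) (t ℓ : ℕ) (ε₁ ε₂ : ℝ) : Prop :=
  ∃ P : Decomp H.verts (Fin t) (Fin ℓ), P.isReg ε₁ ε₂ ∧ P.regWrt H.obar ε₁ ε₂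

def ThreeGraph.Iso (H₁ H₂ : ThreeGraph) : Prop :=
  ∃ f : ℕ → ℕ, Set.BijOn f ↑H₁.verts ↑H₂.verts ∧
    ∀ x ∈ H₁.verts, ∀ y ∈ H₁.verts, ∀ z ∈ H₁.verts,
      (({x, y, z} : Finset ℕ) ∈ H₁.edges ↔ ({f x, f y, f z} : Finset ℕ) ∈ H₂.edges)

def ThreeGraph.induce (H : ThreeGraph) (W : Finset ℕ) : ThreeGraph where
  verts := H.verts ∩ W
  edges := H.edges.filter fun e => e ⊆ W
  edges_sub := by
    intro e he
    rw [Finset.mem_filter] at he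
    obtain ⟨hsub, hcard⟩ := H.edges_sub e he.1
    exact ⟨fun x hx => Finset.mem_inter.mpr ⟨hsub hx, he.2 hx⟩, hcard⟩

/-- A hereditary property of 3-graphs. -/
def Hereditary (ℋ : Set ThreeGraph) : Prop :=
  (∀ H₁ H₂ : ThreeGraph, ThreeGraph.Iso H₁ H₂ → H₁ ∈ ℋ → H₂ ∈ ℋ) ∧
  (∀ H ∈ ℋ, ∀ W : Finset ℕ, H.induce W ∈ ℋ)

/-- The statement `ψ(ε₁,ε₂,T,L,ℋ)`. -/
def psi (ε₁ : ℝ) (ε₂ : ℕ → ℝ) (T L : ℕ) (ℋ : Set ThreeGraph) : Prop :=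
  ∃ n₀ : ℕ, ∀ H ∈ ℋ, n₀ ≤ H.verts.card →
    ∃ t ℓ : ℕ, 1 ≤ t ∧ t ≤ T ∧ 1 ≤ ℓ ∧ ℓ ≤ L ∧ GoodDecomp H t ℓ ε₁ (ε₂ ℓ)

/-- `L_ℋ(ε₁,ε₂)`: minimal `L` such that `ψ(ε₁,ε₂,T,L,ℋ)` holds for some `T ≥ 1`. -/
noncomputable def Lfun (ℋ : Set ThreeGraph) (ε₁ : ℝ) (ε₂ : ℕ → ℝ) : ℕ :=
  sInf {L : ℕ | ∃ T : ℕ, 1 ≤ T ∧ psi ε₁ ε₂ T L ℋ}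

def InZeroOne (f : ℕ → ℝ) : Prop := ∀ x, 0 < f x ∧ f x ≤ 1

/-- "For all sufficiently small `ε₁ > 0` and all `ε₂` tending to `0` sufficiently fast, `Φ`". -/
def SmallEps (Φ : ℝ → (ℕ → ℝ) → Prop) : Prop :=
  ∃ e₁ : ℝ, 0 < e₁ ∧ ∀ ε₁ : ℝ, 0 < ε₁ → ε₁ < e₁ →
    ∃ δ : ℕ → ℝ, InZeroOne δ ∧
      ∀ ε₂ : ℕ → ℝ, InZeroOne ε₂ → (∀ x, ε₂ x ≤ δ x) → Φ ε₁ ε₂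

/-- The `VC₂`-dimension of `H` is at least `k`. -/
def ThreeGraph.VC2AtLeast (H : ThreeGraph) (k : ℕ) : Prop :=
  ∃ a b : Fin k → ℕ, ∃ c : Finset (Fin k × Fin k) → ℕ,
    (∀ i, a i ∈ H.verts) ∧ (∀ i, b i ∈ H.verts) ∧ (∀ S, c S ∈ H.verts) ∧
    ∀ (i j : Fin k) (S : Finset (Fin k × Fin k)),
      (({a i, b j, c S} : Finset ℕ) ∈ H.edges ↔ (i, j) ∈ S)

/-- `K₃[A,B,C]`: the triples meeting each of `A`, `B`, `C`. -/
def K3Parts (A B C : Finset ℕ) : Finset (Finset ℕ) :=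
  (A ×ˢ B ×ˢ C).image fun p => ({p.1, p.2.1, p.2.2} : Finset ℕ)

/-- Neighborhood of `u` in the pair-set `W`, inside ambient set `V`. -/
def Nbhd (V : Finset ℕ) (W : Finset (ℕ × ℕ)) (u : ℕ) : Finset ℕ :=
  V.filter fun v => (u, v) ∈ W

/-- An edge-colored bigraph `(U,V;E₀,E₁,E₂)`. -/
structure ECBigraph where
  left : Finset ℕ
  right : Finset ℕ
  E0 : Finset (ℕ × ℕ)
  E1 : Finset (ℕ × ℕ)
  E2 : Finset (ℕ × ℕ)
  disj01 : Disjoint E0 E1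
  disj02 : Disjoint E0 E2
  disj12 : Disjoint E1 E2
  cover : E0 ∪ E1 ∪ E2 = left ×ˢ right

/-- `G` contains an `E₀/E₁`-copy of `U_bg(k)`. -/
def ECBigraph.CopyUbg (G : ECBigraph) (k : ℕ) : Prop :=
  ∃ u : Finset (Fin k) → ℕ, ∃ v : Fin k → ℕ,
    (∀ S, u S ∈ G.left) ∧ (∀ i, v i ∈ G.right) ∧
    ∀ (S : Finset (Fin k)) (i : Fin k),
      (i ∈ S → (u S, v i) ∈ G.E1) ∧ (i ∉ S → (u S, v i) ∈ G.E0)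

/-- `G` contains an `E₀/E₁`-copy of the bigraph `R`. -/
def ECBigraph.Copy01 (G : ECBigraph) (R : Bigraph) : Prop :=
  ∃ u v : ℕ → ℕ,
    (∀ a ∈ R.left, u a ∈ G.left) ∧ (∀ b ∈ R.right, v b ∈ G.right) ∧
    ∀ a ∈ R.left, ∀ b ∈ R.right,
      ((a, b) ∈ R.edges → (u a, v b) ∈ G.E1) ∧ ((a, b) ∉ R.edges → (u a, v b) ∈ G.E0)

/-- `K₂[A,B]`: the crossing (unordered) pairs. -/
def pairsAB (A B : Finset ℕ) : Finset (Finset ℕ) :=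
  (A ×ˢ B).image fun p => ({p.1, p.2} : Finset ℕ)

/-- A bipartite `U`-colored graph `Γ = (A ∪ B, (P_u)_{u ∈ U})`. -/
structure BipColored (U : Finset ℕ) where
  A : Finset ℕ
  B : Finset ℕ
  disjAB : Disjoint A B
  P : ℕ → Finset (Finset ℕ)
  P_disj : ∀ u ∈ U, ∀ u' ∈ U, u ≠ u' → Disjoint (P u) (P u')
  P_cover : U.biUnion P = pairsAB A B

/-- The bipartite graph `(A ∪ B, P_u)` of a color, as a bigraph (ordered pairs `P̄_u`). -/
def BipColored.colorBG {U : Finset ℕ} (Γ : BipColored U) (u : ℕ) : Bigraph where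
  left := Γ.A
  right := Γ.B
  edges := (Γ.A ×ˢ Γ.B).filter fun p => ({p.1, p.2} : Finset ℕ) ∈ Γ.P u
  edges_sub := Finset.filter_subset _ _

/-- `H` is an `(n,Γ)`-blowup of `G` with the explicit family `Cfam` of new vertex classes. -/
def IsBlowupWith (G : Bigraph) (n : ℕ) (Γ : BipColored G.left) (Cfam : ℕ → Finset ℕ)
    (H : ThreeGraph) : Prop :=
  (∀ v ∈ G.right, (Cfam v).card = n) ∧
  (∀ v ∈ G.right, ∀ v' ∈ G.right, v ≠ v' → Disjoint (Cfam v) (Cfam v')) ∧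
  (∀ v ∈ G.right, Disjoint (Cfam v) (Γ.A ∪ Γ.B)) ∧
  H.verts = Γ.A ∪ Γ.B ∪ G.right.biUnion Cfam ∧
  ∀ u ∈ G.left, ∀ v ∈ G.right, ∀ e ∈ Γ.P u, ∀ z ∈ Cfam v,
    (((u, v) ∈ G.edges → insert z e ∈ H.edges) ∧ ((u, v) ∉ G.edges → insert z e ∉ H.edges))

def IsBlowup (G : Bigraph) (n : ℕ) (Γ : BipColored G.left) (H : ThreeGraph) : Prop :=
  ∃ Cfam : ℕ → Finset ℕ, IsBlowupWith G n Γ Cfam H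

def ThreeGraph.ContainsInduced (H H' : ThreeGraph) : Prop :=
  ∃ W : Finset ℕ, ThreeGraph.Iso (H.induce W) H'

/-- The `G`-dimension of `H` is at least `n`. -/
def GDimAtLeast (G : Bigraph) (H : ThreeGraph) (n : ℕ) : Prop :=
  ∀ Γ : BipColored G.left, Γ.A.card = n → Γ.B.card = n →
    ∃ H' : ThreeGraph, IsBlowup G n Γ H' ∧ H.ContainsInduced H'

/-- `G ∈ B_ℋ`: `G` is irreducible and `ℋ` has infinite `G`-dimension. -/
def InBH (ℋ : Set ThreeGraph) (G : Bigraph) : Prop :=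
  G.Irreducible ∧ ∀ m : ℕ, ∃ H ∈ ℋ, GDimAtLeast G H m

/-- An encoding of the bigraph `R` in `(H,P)`, where `Rtrip = Ē(H)`. -/
def Encoding {V : Finset ℕ} {t ℓ : ℕ} (R : Bigraph) (Rtrip : Finset (ℕ × ℕ × ℕ))
    (P : Decomp V (Fin t) (Fin ℓ)) (ε₂ : ℝ) : Prop :=
  ∃ j₀ k₀ : Fin t, j₀ ≠ k₀ ∧
    ∃ f : ℕ → Fin ℓ, ∃ g : ℕ → Fin t × Fin ℓ × Fin ℓ,
      (∀ u ∈ R.left, (P.pairBG j₀ k₀ (f u)).dev2 ε₂ (1 / (ℓ : ℝ))) ∧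
      (∀ v ∈ R.right,
        (P.pairBG (g v).1 j₀ (g v).2.1).dev2 ε₂ (1 / (ℓ : ℝ)) ∧
        (P.pairBG (g v).1 k₀ (g v).2.2).dev2 ε₂ (1 / (ℓ : ℝ))) ∧
      ∀ u ∈ R.left, ∀ v ∈ R.right,
        (((u, v) ∈ R.edges →
          ((P.triadOf (g v).1 j₀ k₀ (g v).2.1 (g v).2.2 (f u)).K3.card : ℝ) / 2 ≤
            ((Rtrip ∩ (P.triadOf (g v).1 j₀ k₀ (g v).2.1 (g v).2.2 (f u)).K3).card : ℝ)) ∧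
         ((u, v) ∉ R.edges →
          ((Rtrip ∩ (P.triadOf (g v).1 j₀ k₀ (g v).2.1 (g v).2.2 (f u)).K3).card : ℝ) <
            ((P.triadOf (g v).1 j₀ k₀ (g v).2.1 (g v).2.2 (f u)).K3.card : ℝ) / 2))

def encodeSet (S : Finset ℕ) : ℕ := ∑ i ∈ S, 2 ^ i

/-- The bigraph `U_bg(k)` realized on `ℕ`, with subsets of `[k]` encoded in binary. -/
def Ubg (k : ℕ) : Bigraph where
  left := ((Finset.range k).powerset).image encodeSet
  right := Finset.range k
  edges := ((Finset.range k).powerset).biUnion fun S => S.image fun i => (encodeSet S, i)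
  edges_sub := by
    intro p hp
    simp only [Finset.mem_biUnion, Finset.mem_image, Finset.mem_powerset] at hp
    obtain ⟨S, hS, i, hi, rfl⟩ := hp
    refine Finset.mem_product.mpr ⟨?_, ?_⟩
    · exact Finset.mem_image.mpr ⟨S, Finset.mem_powerset.mpr hS, rfl⟩
    · exact hS hi

/-- The real-valued indicator of a set of pairs. -/
noncomputable def pairInd (E : Finset (ℕ × ℕ)) (x y : ℕ) : ℝ := if (x, y) ∈ E then 1 else 0

lemma pairInd_nonneg (E : Finset (ℕ × ℕ)) (x y : ℕ) : 0 ≤ pairInd E x y := by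
  unfold pairInd; split_ifs <;> norm_num

lemma pairInd_le_one (E : Finset (ℕ × ℕ)) (x y : ℕ) : pairInd E x y ≤ 1 := by
  unfold pairInd; split_ifs <;> norm_num

lemma sum_pairInd {E : Finset (ℕ × ℕ)} {X Y : Finset ℕ} (h : E ⊆ X ×ˢ Y) :
    ∑ x ∈ X, ∑ y ∈ Y, pairInd E x y = (E.card : ℝ) := by
  rw [← Finset.sum_product' X Y (fun x y => pairInd E x y)]
  simp only [pairInd, Prod.mk.eta, Finset.sum_boole]
  rw [Finset.filter_mem_eq_inter, Finset.inter_eq_right.mpr h]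

section CauchySchwarz

variable {ι₁ ι₂ ι₃ ι₄ : Type*}

lemma sum_mul_sq_le₂ (X : Finset ι₁) (Y : Finset ι₂) (f g : ι₁ → ι₂ → ℝ) :
    (∑ x ∈ X, ∑ y ∈ Y, f x y * g x y) ^ 2 ≤
      (∑ x ∈ X, ∑ y ∈ Y, f x y ^ 2) * ∑ x ∈ X, ∑ y ∈ Y, g x y ^ 2 := by
  simp only [← Finset.sum_product']
  exact Finset.sum_mul_sq_le_sq_mul_sq _ _ _

lemma sum_mul_sq_le₃ (X : Finset ι₁) (Y : Finset ι₂) (Z : Finset ι₃) (f g : ι₁ → ι₂ → ι₃ → ℝ) :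
    (∑ x ∈ X, ∑ y ∈ Y, ∑ z ∈ Z, f x y z * g x y z) ^ 2 ≤
      (∑ x ∈ X, ∑ y ∈ Y, ∑ z ∈ Z, f x y z ^ 2) * ∑ x ∈ X, ∑ y ∈ Y, ∑ z ∈ Z, g x y z ^ 2 := by
  have := sum_mul_sq_le₂ X (Y ×ˢ Z) (fun x p => f x p.1 p.2) (fun x p => g x p.1 p.2)
  simpa only [Finset.sum_product] using this

lemma sum_mul_sq_le₄ (X : Finset ι₁) (Y : Finset ι₂) (Z : Finset ι₃) (W : Finset ι₄)
    (f g : ι₁ → ι₂ → ι₃ → ι₄ → ℝ) :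
    (∑ x ∈ X, ∑ y ∈ Y, ∑ z ∈ Z, ∑ w ∈ W, f x y z w * g x y z w) ^ 2 ≤
      (∑ x ∈ X, ∑ y ∈ Y, ∑ z ∈ Z, ∑ w ∈ W, f x y z w ^ 2) *
        ∑ x ∈ X, ∑ y ∈ Y, ∑ z ∈ Z, ∑ w ∈ W, g x y z w ^ 2 := by
  have := sum_mul_sq_le₃ X Y (Z ×ˢ W) (fun x y p => f x y p.1 p.2) (fun x y p => g x y p.1 p.2)
  simpa only [Finset.sum_product] using this

lemma sum_sq_eq_sum_sum (X : Finset ι₁) (f : ι₁ → ℝ) :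
    (∑ x ∈ X, f x) ^ 2 = ∑ x₀ ∈ X, ∑ x₁ ∈ X, f x₀ * f x₁ := by
  rw [sq, Finset.sum_mul_sum]

end CauchySchwarz

/-- `g` has cut norm at most `κ|X||Y|` against `[-1,1]`-valued test functions. -/
def CutSmall (X Y : Finset ℕ) (g : ℕ → ℕ → ℝ) (κ : ℝ) : Prop :=
  ∀ u w : ℕ → ℝ, (∀ x, |u x| ≤ 1) → (∀ y, |w y| ≤ 1) →
    |∑ x ∈ X, ∑ y ∈ Y, u x * w y * g x y| ≤ κ * X.card * Y.card

lemma sq_le_one_of_abs {a : ℝ} (h : |a| ≤ 1) : a ^ 2 ≤ 1 := (sq_le_one_iff_abs_le_one a).mpr h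

lemma cutSmall_of_boxSum_le {X Y : Finset ℕ} {g : ℕ → ℕ → ℝ} {κ : ℝ} (hκ : 0 ≤ κ)
    (h : ∑ x₀ ∈ X, ∑ x₁ ∈ X, ∑ y₀ ∈ Y, ∑ y₁ ∈ Y, g x₀ y₀ * g x₀ y₁ * g x₁ y₀ * g x₁ y₁ ≤
      κ ^ 4 * (X.card : ℝ) ^ 2 * (Y.card : ℝ) ^ 2) : CutSmall X Y g κ := by
  intro u w hu hw
  set S := ∑ x ∈ X, ∑ y ∈ Y, u x * w y * g x y with hS
  set T := ∑ y₀ ∈ Y, ∑ y₁ ∈ Y, (w y₀ * w y₁) * ∑ x ∈ X, g x y₀ * g x y₁ with hT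
  have h1 : S ^ 2 ≤ X.card * T := by
    have hs : S = ∑ x ∈ X, u x * ∑ y ∈ Y, w y * g x y := by
      simp only [hS, Finset.mul_sum, mul_assoc]
    have ht : ∑ x ∈ X, (∑ y ∈ Y, w y * g x y) ^ 2 = T := by
      simp only [sum_sq_eq_sum_sum, hT, Finset.mul_sum]
      rw [Finset.sum_comm]
      refine Finset.sum_congr rfl fun y₀ _ => ?_
      rw [Finset.sum_comm]
      exact Finset.sum_congr rfl fun y₁ _ => Finset.sum_congr rfl fun x _ => by ring
    rw [hs, ← ht]
    refine (Finset.sum_mul_sq_le_sq_mul_sq _ _ _).trans ?_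
    refine mul_le_mul_of_nonneg_right ?_ (Finset.sum_nonneg fun _ _ => sq_nonneg _)
    calc ∑ x ∈ X, u x ^ 2 ≤ ∑ x ∈ X, (1 : ℝ) :=
          Finset.sum_le_sum fun x _ => sq_le_one_of_abs (hu x)
      _ = X.card := by simp
  have h2 : T ^ 2 ≤ (Y.card : ℝ) ^ 2 * (κ ^ 4 * (X.card : ℝ) ^ 2 * (Y.card : ℝ) ^ 2) := by
    refine (sum_mul_sq_le₂ _ _ _ _).trans ?_
    refine mul_le_mul ?_ (le_trans (le_of_eq ?_) h) ?_ (by positivity)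
    · calc ∑ y₀ ∈ Y, ∑ y₁ ∈ Y, (w y₀ * w y₁) ^ 2 ≤ ∑ y₀ ∈ Y, ∑ y₁ ∈ Y, (1 : ℝ) := by
            refine Finset.sum_le_sum fun y₀ _ => Finset.sum_le_sum fun y₁ _ => ?_
            rw [mul_pow]
            exact mul_le_one₀ (sq_le_one_of_abs (hw _)) (sq_nonneg _) (sq_le_one_of_abs (hw _))
        _ = (Y.card : ℝ) ^ 2 := by simp [sq]
    · simp only [sum_sq_eq_sum_sum]
      rw [← Finset.sum_product' Y Y (fun y₀ y₁ => ∑ x₀ ∈ X, ∑ x₁ ∈ X,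
        g x₀ y₀ * g x₀ y₁ * (g x₁ y₀ * g x₁ y₁)), Finset.sum_comm]
      refine Finset.sum_congr rfl fun x₀ _ => ?_
      rw [Finset.sum_comm]
      refine Finset.sum_congr rfl fun x₁ _ => ?_
      rw [Finset.sum_product]
      exact Finset.sum_congr rfl fun y₀ _ => Finset.sum_congr rfl fun y₁ _ => by ring
    · exact Finset.sum_nonneg fun _ _ => Finset.sum_nonneg fun _ _ => sq_nonneg _
  have h3 : |S| ^ 4 ≤ (κ * X.card * Y.card) ^ 4 := by
    calc |S| ^ 4 = (S ^ 2) ^ 2 := by rw [← sq_abs S]; ring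
      _ ≤ (X.card * T) ^ 2 := by gcongr
      _ = (X.card : ℝ) ^ 2 * T ^ 2 := by ring
      _ ≤ (X.card : ℝ) ^ 2 *
          ((Y.card : ℝ) ^ 2 * (κ ^ 4 * (X.card : ℝ) ^ 2 * (Y.card : ℝ) ^ 2)) := by gcongr
      _ = _ := by ring
  exact le_of_pow_le_pow_left₀ (by norm_num) (by positivity) h3

section Counting

variable {X Y Z : Finset ℕ} {φ ψ : ℕ → ℕ → ℝ} {d d' κ : ℝ}

lemma abs_le_one_of_unit {a : ℝ} (h0 : 0 ≤ a) (h1 : a ≤ 1) : |a| ≤ 1 := by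
  rwa [abs_of_nonneg h0]

lemma sum_sub_le_of_cutSmall (h : CutSmall X Y (fun x y => φ x y - d) κ) {u w : ℕ → ℝ}
    (hu : ∀ x, |u x| ≤ 1) (hw : ∀ y, |w y| ≤ 1) :
    ∑ x ∈ X, ∑ y ∈ Y, u x * w y * φ x y ≤
      d * (∑ x ∈ X, ∑ y ∈ Y, u x * w y) + κ * X.card * Y.card := by
  have := (abs_le.mp (h u w hu hw)).2
  simp only [mul_sub, Finset.sum_sub_distrib] at this
  have e : ∑ x ∈ X, ∑ y ∈ Y, u x * w y * d = d * (∑ x ∈ X, ∑ y ∈ Y, u x * w y) := by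
    simp only [Finset.mul_sum]
    exact Finset.sum_congr rfl fun _ _ => Finset.sum_congr rfl fun _ _ => by ring
  linarith

lemma le_sum_of_cutSmall (h : CutSmall X Y (fun x y => φ x y - d) κ) {u w : ℕ → ℝ}
    (hu : ∀ x, |u x| ≤ 1) (hw : ∀ y, |w y| ≤ 1) :
    d * (∑ x ∈ X, ∑ y ∈ Y, u x * w y) - κ * X.card * Y.card ≤
      ∑ x ∈ X, ∑ y ∈ Y, u x * w y * φ x y := by
  have := (abs_le.mp (h u w hu hw)).1
  simp only [mul_sub, Finset.sum_sub_distrib] at this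
  have e : ∑ x ∈ X, ∑ y ∈ Y, u x * w y * d = d * (∑ x ∈ X, ∑ y ∈ Y, u x * w y) := by
    simp only [Finset.mul_sum]
    exact Finset.sum_congr rfl fun _ _ => Finset.sum_congr rfl fun _ _ => by ring
  linarith

/-- Upper bound on the number of cherries with centre in `X`. -/
lemma cherry_le_of_cutSmall (h : CutSmall X Y (fun x y => φ x y - d) κ)
    (hφ0 : ∀ x y, 0 ≤ φ x y) (hφ1 : ∀ x y, φ x y ≤ 1) (hd0 : 0 ≤ d) (hd1 : d ≤ 1) (hκ : 0 ≤ κ) :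
    ∑ x ∈ X, ∑ y₀ ∈ Y, ∑ y₁ ∈ Y, φ x y₀ * φ x y₁ ≤
      (d ^ 2 + 2 * κ) * X.card * (Y.card : ℝ) ^ 2 := by
  have hE : ∑ x ∈ X, ∑ y ∈ Y, φ x y ≤ (d + κ) * X.card * Y.card := by
    have := sum_sub_le_of_cutSmall h (u := fun _ => 1) (w := fun _ => 1) (by simp) (by simp)
    simp at this
    linarith
  calc ∑ x ∈ X, ∑ y₀ ∈ Y, ∑ y₁ ∈ Y, φ x y₀ * φ x y₁
      = ∑ y₀ ∈ Y, ∑ x ∈ X, ∑ y₁ ∈ Y, φ x y₀ * 1 * φ x y₁ := by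
        rw [Finset.sum_comm]; simp
    _ ≤ ∑ y₀ ∈ Y, (d * (∑ x ∈ X, ∑ y₁ ∈ Y, φ x y₀ * 1) + κ * X.card * Y.card) :=
        Finset.sum_le_sum fun y₀ _ => sum_sub_le_of_cutSmall h (u := fun x => φ x y₀)
          (w := fun _ => 1) (fun x => abs_le_one_of_unit (hφ0 _ _) (hφ1 _ _)) (by simp)
    _ = d * Y.card * (∑ x ∈ X, ∑ y ∈ Y, φ x y) + κ * X.card * (Y.card : ℝ) ^ 2 := by
        rw [Finset.sum_add_distrib, ← Finset.mul_sum, Finset.sum_comm (s := X) (t := Y)]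
        simp [← Finset.mul_sum]; ring
    _ ≤ d * Y.card * ((d + κ) * X.card * Y.card) + κ * X.card * (Y.card : ℝ) ^ 2 := by gcongr
    _ = (d ^ 2 + (d + 1) * κ) * X.card * (Y.card : ℝ) ^ 2 := by ring
    _ ≤ _ := by gcongr; linarith

/-- Upper bound on the number of four-cycles. -/
lemma fourCycle_le_of_cutSmall (h : CutSmall X Y (fun x y => φ x y - d) κ)
    (hφ0 : ∀ x y, 0 ≤ φ x y) (hφ1 : ∀ x y, φ x y ≤ 1) (hd0 : 0 ≤ d) (hd1 : d ≤ 1) (hκ : 0 ≤ κ) :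
    ∑ x₀ ∈ X, ∑ x₁ ∈ X, ∑ y₀ ∈ Y, ∑ y₁ ∈ Y, φ x₀ y₀ * φ x₀ y₁ * φ x₁ y₀ * φ x₁ y₁ ≤
      (d ^ 4 + 4 * κ) * (X.card : ℝ) ^ 2 * (Y.card : ℝ) ^ 2 := by
  have hP := cherry_le_of_cutSmall h hφ0 hφ1 hd0 hd1 hκ
  have hab : ∀ x y, |φ x y| ≤ 1 := fun x y => abs_le_one_of_unit (hφ0 _ _) (hφ1 _ _)
  have hab2 : ∀ x y x' y', |φ x y * φ x' y'| ≤ 1 := fun x y x' y' => by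
    rw [abs_mul]; exact mul_le_one₀ (hab _ _) (abs_nonneg _) (hab _ _)
  -- three edges
  have hP3 : ∑ x₁ ∈ X, ∑ y₁ ∈ Y, ∑ x₀ ∈ X, ∑ y₀ ∈ Y, φ x₀ y₁ * (φ x₁ y₀ * φ x₁ y₁) ≤
      d * X.card * ((d ^ 2 + 2 * κ) * X.card * (Y.card : ℝ) ^ 2) +
        κ * (X.card : ℝ) ^ 2 * (Y.card : ℝ) ^ 2 := by
    calc ∑ x₁ ∈ X, ∑ y₁ ∈ Y, ∑ x₀ ∈ X, ∑ y₀ ∈ Y, φ x₀ y₁ * (φ x₁ y₀ * φ x₁ y₁)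
        = ∑ x₁ ∈ X, ∑ y₀ ∈ Y, ∑ x₀ ∈ X, ∑ y₁ ∈ Y, 1 * (φ x₁ y₀ * φ x₁ y₁) * φ x₀ y₁ := by
          refine Finset.sum_congr rfl fun x₁ _ => ?_
          rw [Finset.sum_comm]
          conv_rhs => rw [Finset.sum_comm]
          refine Finset.sum_congr rfl fun x₀ _ => ?_
          rw [Finset.sum_comm]
          exact Finset.sum_congr rfl fun _ _ => Finset.sum_congr rfl fun _ _ => by ring
      _ ≤ ∑ x₁ ∈ X, ∑ y₀ ∈ Y, (d * (∑ x₀ ∈ X, ∑ y₁ ∈ Y, 1 * (φ x₁ y₀ * φ x₁ y₁)) +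
            κ * X.card * Y.card) :=
          Finset.sum_le_sum fun x₁ _ => Finset.sum_le_sum fun y₀ _ =>
            sum_sub_le_of_cutSmall h (u := fun _ => 1) (w := fun y₁ => φ x₁ y₀ * φ x₁ y₁)
              (by simp) (fun y₁ => hab2 _ _ _ _)
      _ = d * X.card * (∑ x ∈ X, ∑ y₀ ∈ Y, ∑ y₁ ∈ Y, φ x y₀ * φ x y₁) +
            κ * (X.card : ℝ) ^ 2 * (Y.card : ℝ) ^ 2 := by
          simp only [Finset.sum_add_distrib]
          congr 1
          · simp only [one_mul, Finset.sum_const, nsmul_eq_mul, Finset.mul_sum]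
            exact Finset.sum_congr rfl fun _ _ => Finset.sum_congr rfl fun _ _ =>
              Finset.sum_congr rfl fun _ _ => by ring
          · simp only [Finset.sum_const, nsmul_eq_mul]
            ring
      _ ≤ _ := by gcongr
  calc ∑ x₀ ∈ X, ∑ x₁ ∈ X, ∑ y₀ ∈ Y, ∑ y₁ ∈ Y, φ x₀ y₀ * φ x₀ y₁ * φ x₁ y₀ * φ x₁ y₁
      = ∑ x₁ ∈ X, ∑ y₁ ∈ Y, ∑ x₀ ∈ X, ∑ y₀ ∈ Y, φ x₀ y₁ * (φ x₁ y₀ * φ x₁ y₁) * φ x₀ y₀ := by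
        rw [Finset.sum_comm]
        refine Finset.sum_congr rfl fun x₁ _ => ?_
        rw [Finset.sum_comm (s := Y) (t := X)]
        refine Finset.sum_congr rfl fun x₀ _ => ?_
        rw [Finset.sum_comm]
        exact Finset.sum_congr rfl fun _ _ => Finset.sum_congr rfl fun _ _ => by ring
    _ ≤ ∑ x₁ ∈ X, ∑ y₁ ∈ Y, (d * (∑ x₀ ∈ X, ∑ y₀ ∈ Y, φ x₀ y₁ * (φ x₁ y₀ * φ x₁ y₁)) +
          κ * X.card * Y.card) := by
        refine Finset.sum_le_sum fun x₁ _ => Finset.sum_le_sum fun y₁ _ => ?_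
        exact sum_sub_le_of_cutSmall h (u := fun x₀ => φ x₀ y₁)
          (w := fun y₀ => φ x₁ y₀ * φ x₁ y₁) (fun _ => hab _ _) (fun _ => hab2 _ _ _ _)
    _ = d * (∑ x₁ ∈ X, ∑ y₁ ∈ Y, ∑ x₀ ∈ X, ∑ y₀ ∈ Y, φ x₀ y₁ * (φ x₁ y₀ * φ x₁ y₁)) +
          κ * (X.card : ℝ) ^ 2 * (Y.card : ℝ) ^ 2 := by
        simp only [Finset.sum_add_distrib, ← Finset.mul_sum, Finset.sum_const, nsmul_eq_mul]
        ring
    _ ≤ d * (d * X.card * ((d ^ 2 + 2 * κ) * X.card * (Y.card : ℝ) ^ 2) +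
          κ * (X.card : ℝ) ^ 2 * (Y.card : ℝ) ^ 2) + κ * (X.card : ℝ) ^ 2 * (Y.card : ℝ) ^ 2 := by
        gcongr
    _ = (d ^ 4 + (2 * d ^ 2 + d + 1) * κ) * (X.card : ℝ) ^ 2 * (Y.card : ℝ) ^ 2 := by ring
    _ ≤ _ := by gcongr; nlinarith

/-- Lower bound on the number of triangles over a weighted set `F` of pairs and `w` of vertices. -/
lemma le_triangles_of_cutSmall (hφ : CutSmall X Z (fun x z => φ x z - d) κ)
    (hψ : CutSmall Y Z (fun y z => ψ y z - d') κ)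
    (hψ0 : ∀ x y, 0 ≤ ψ x y) (hψ1 : ∀ x y, ψ x y ≤ 1) (hd0 : 0 ≤ d) (hd1 : d ≤ 1) (hκ : 0 ≤ κ)
    {F : ℕ → ℕ → ℝ} {w : ℕ → ℝ} (hF0 : ∀ x y, 0 ≤ F x y) (hF1 : ∀ x y, F x y ≤ 1)
    (hw0 : ∀ z, 0 ≤ w z) (hw1 : ∀ z, w z ≤ 1) :
    d * d' * (∑ x ∈ X, ∑ y ∈ Y, F x y) * (∑ z ∈ Z, w z) - 2 * κ * X.card * Y.card * Z.card ≤
      ∑ x ∈ X, ∑ y ∈ Y, ∑ z ∈ Z, F x y * w z * (φ x z * ψ y z) := by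
  have h1 : d' * ((∑ x ∈ X, ∑ y ∈ Y, F x y) * ∑ z ∈ Z, w z) - κ * X.card * Y.card * Z.card ≤
      ∑ x ∈ X, ∑ y ∈ Y, ∑ z ∈ Z, F x y * w z * ψ y z := by
    calc _ = ∑ x ∈ X, (d' * (∑ y ∈ Y, ∑ z ∈ Z, F x y * w z) - κ * Y.card * Z.card) := by
          simp only [Finset.sum_sub_distrib, Finset.sum_const, nsmul_eq_mul, ← Finset.mul_sum,
            ← Finset.sum_mul]
          ring
      _ ≤ _ := Finset.sum_le_sum fun x _ => le_sum_of_cutSmall hψ (u := fun y => F x y) (w := w)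
          (fun y => abs_le_one_of_unit (hF0 _ _) (hF1 _ _))
          (fun z => abs_le_one_of_unit (hw0 _) (hw1 _))
  calc _ ≤ d * (∑ x ∈ X, ∑ y ∈ Y, ∑ z ∈ Z, F x y * w z * ψ y z) -
          κ * X.card * Y.card * Z.card := by
        have h2 := mul_le_mul_of_nonneg_left h1 hd0
        have h3 : d * (κ * X.card * Y.card * Z.card) ≤ 1 * (κ * X.card * Y.card * Z.card) := by
          gcongr
        linarith
    _ = ∑ y ∈ Y, (d * (∑ x ∈ X, ∑ z ∈ Z, F x y * (w z * ψ y z)) - κ * X.card * Z.card) := by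
        rw [Finset.sum_sub_distrib, ← Finset.mul_sum, Finset.sum_comm]
        simp only [Finset.sum_const, nsmul_eq_mul, mul_assoc]
        ring
    _ ≤ ∑ y ∈ Y, ∑ x ∈ X, ∑ z ∈ Z, F x y * (w z * ψ y z) * φ x z := by
        refine Finset.sum_le_sum fun y _ => le_sum_of_cutSmall hφ (u := fun x => F x y)
          (w := fun z => w z * ψ y z) (fun x => abs_le_one_of_unit (hF0 _ _) (hF1 _ _))
          (fun z => abs_le_one_of_unit (mul_nonneg (hw0 _) (hψ0 _ _))
            (mul_le_one₀ (hw1 _) (hψ0 _ _) (hψ1 _ _)))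
    _ = _ := by
        rw [Finset.sum_comm]
        exact Finset.sum_congr rfl fun _ _ => Finset.sum_congr rfl fun _ _ =>
          Finset.sum_congr rfl fun _ _ => by ring

end Counting

/-- The relative Gowers–Cauchy–Schwarz inequality: a function supported on the triangles of a triad
correlates with (pairs) × (vertices) at most as its octahedral sum allows. -/
lemma correlation_pow_eight_le (X Y Z : Finset ℕ) (h : ℕ → ℕ → ℕ → ℝ) (p φ ψ F : ℕ → ℕ → ℝ)
    (w : ℕ → ℝ) (hp : ∀ x y z, p x y * h x y z = h x y z)
    (hφ : ∀ x y z, φ x z * h x y z = h x y z) (hψ : ∀ x y z, ψ y z * h x y z = h x y z)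
    (hp0 : ∀ x y, 0 ≤ p x y) (hp1 : ∀ x y, p x y ≤ 1)
    (hφ0 : ∀ x y, 0 ≤ φ x y) (hφ1 : ∀ x y, φ x y ≤ 1)
    (hψ0 : ∀ x y, 0 ≤ ψ x y) (hψ1 : ∀ x y, ψ x y ≤ 1)
    (hF0 : ∀ x y, 0 ≤ F x y) (hF1 : ∀ x y, F x y ≤ 1)
    (hw0 : ∀ z, 0 ≤ w z) (hw1 : ∀ z, w z ≤ 1) :
    (∑ x ∈ X, ∑ y ∈ Y, ∑ z ∈ Z, F x y * w z * h x y z) ^ 8 ≤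
      (∑ x ∈ X, ∑ y ∈ Y, p x y) ^ 4 *
      (∑ x ∈ X, ∑ z₀ ∈ Z, ∑ z₁ ∈ Z, φ x z₀ * φ x z₁) ^ 2 *
      (∑ y₀ ∈ Y, ∑ y₁ ∈ Y, ∑ z₀ ∈ Z, ∑ z₁ ∈ Z, ψ y₀ z₀ * ψ y₀ z₁ * ψ y₁ z₀ * ψ y₁ z₁) *
      ∑ x₀ ∈ X, ∑ x₁ ∈ X, ∑ y₀ ∈ Y, ∑ y₁ ∈ Y, ∑ z₀ ∈ Z, ∑ z₁ ∈ Z,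
        h x₀ y₀ z₀ * h x₀ y₀ z₁ * h x₀ y₁ z₀ * h x₀ y₁ z₁ *
          h x₁ y₀ z₀ * h x₁ y₀ z₁ * h x₁ y₁ z₀ * h x₁ y₁ z₁ := by
  have sq_le : ∀ a : ℝ, 0 ≤ a → a ≤ 1 → a ^ 2 ≤ a := fun a h0 h1 => by nlinarith
  set S := ∑ x ∈ X, ∑ y ∈ Y, ∑ z ∈ Z, F x y * w z * h x y z with hS
  set N₁ := ∑ x ∈ X, ∑ y ∈ Y, p x y with hN₁
  set N₂ := ∑ x ∈ X, ∑ z₀ ∈ Z, ∑ z₁ ∈ Z, φ x z₀ * φ x z₁ with hN₂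
  set N₃ := ∑ y₀ ∈ Y, ∑ y₁ ∈ Y, ∑ z₀ ∈ Z, ∑ z₁ ∈ Z, ψ y₀ z₀ * ψ y₀ z₁ * ψ y₁ z₀ * ψ y₁ z₁ with hN₃
  set O := ∑ x₀ ∈ X, ∑ x₁ ∈ X, ∑ y₀ ∈ Y, ∑ y₁ ∈ Y, ∑ z₀ ∈ Z, ∑ z₁ ∈ Z,
        h x₀ y₀ z₀ * h x₀ y₀ z₁ * h x₀ y₁ z₀ * h x₀ y₁ z₁ *
          h x₁ y₀ z₀ * h x₁ y₀ z₁ * h x₁ y₁ z₀ * h x₁ y₁ z₁ with hO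
  set T := ∑ x ∈ X, ∑ z₀ ∈ Z, ∑ z₁ ∈ Z,
    (w z₀ * w z₁ * (φ x z₀ * φ x z₁)) * ∑ y ∈ Y, h x y z₀ * h x y z₁ with hT
  set Q := ∑ y₀ ∈ Y, ∑ y₁ ∈ Y, ∑ z₀ ∈ Z, ∑ z₁ ∈ Z, (ψ y₀ z₀ * ψ y₀ z₁ * ψ y₁ z₀ * ψ y₁ z₁) *
    ∑ x ∈ X, h x y₀ z₀ * h x y₀ z₁ * h x y₁ z₀ * h x y₁ z₁ with hQ
  have N₁_nonneg : 0 ≤ N₁ := Finset.sum_nonneg fun _ _ => Finset.sum_nonneg fun _ _ => hp0 _ _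
  have N₂_nonneg : 0 ≤ N₂ := Finset.sum_nonneg fun _ _ => Finset.sum_nonneg fun _ _ =>
    Finset.sum_nonneg fun _ _ => mul_nonneg (hφ0 _ _) (hφ0 _ _)
  have hST : S ^ 2 ≤ N₁ * T := by
    have e1 : S = ∑ x ∈ X, ∑ y ∈ Y, (F x y * p x y) * ∑ z ∈ Z, w z * h x y z := by
      refine Finset.sum_congr rfl fun x _ => Finset.sum_congr rfl fun y _ => ?_
      rw [Finset.mul_sum]
      refine Finset.sum_congr rfl fun z _ => ?_
      conv_lhs => rw [← hp]
      ring
    have e2 : ∑ x ∈ X, ∑ y ∈ Y, (∑ z ∈ Z, w z * h x y z) ^ 2 = T := by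
      refine Finset.sum_congr rfl fun x _ => ?_
      simp only [sum_sq_eq_sum_sum, Finset.mul_sum]
      rw [Finset.sum_comm]
      refine Finset.sum_congr rfl fun z₀ _ => ?_
      rw [Finset.sum_comm]
      refine Finset.sum_congr rfl fun z₁ _ => Finset.sum_congr rfl fun y _ => ?_
      conv_lhs => rw [← hφ x y z₀, ← hφ x y z₁]
      ring
    rw [e1, ← e2]
    refine (sum_mul_sq_le₂ _ _ _ _).trans (mul_le_mul_of_nonneg_right ?_ ?_)
    · refine Finset.sum_le_sum fun x _ => Finset.sum_le_sum fun y _ => ?_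
      refine (sq_le _ (mul_nonneg (hF0 _ _) (hp0 _ _))
        (mul_le_one₀ (hF1 _ _) (hp0 _ _) (hp1 _ _))).trans ?_
      exact mul_le_of_le_one_left (hp0 _ _) (hF1 _ _)
    · exact Finset.sum_nonneg fun _ _ => Finset.sum_nonneg fun _ _ => sq_nonneg _
  have hTQ : T ^ 2 ≤ N₂ * Q := by
    have e : ∑ x ∈ X, ∑ z₀ ∈ Z, ∑ z₁ ∈ Z, (∑ y ∈ Y, h x y z₀ * h x y z₁) ^ 2 = Q := by
      have e1 : ∀ x, ∑ z₀ ∈ Z, ∑ z₁ ∈ Z, (∑ y ∈ Y, h x y z₀ * h x y z₁) ^ 2 =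
          ∑ q ∈ (Y ×ˢ Y) ×ˢ (Z ×ˢ Z),
            h x q.1.1 q.2.1 * h x q.1.1 q.2.2 * h x q.1.2 q.2.1 * h x q.1.2 q.2.2 := by
        intro x
        rw [Finset.sum_product_right, Finset.sum_product]
        refine Finset.sum_congr rfl fun z₀ _ => Finset.sum_congr rfl fun z₁ _ => ?_
        rw [sum_sq_eq_sum_sum, Finset.sum_product]
        exact Finset.sum_congr rfl fun _ _ => Finset.sum_congr rfl fun _ _ => by ring
      simp only [e1]
      rw [Finset.sum_comm]
      simp only [Finset.sum_product, hQ]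
      refine Finset.sum_congr rfl fun y₀ _ => Finset.sum_congr rfl fun y₁ _ =>
        Finset.sum_congr rfl fun z₀ _ => Finset.sum_congr rfl fun z₁ _ => ?_
      rw [Finset.mul_sum]
      refine Finset.sum_congr rfl fun x _ => ?_
      conv_lhs => rw [← hψ x y₀ z₀, ← hψ x y₀ z₁, ← hψ x y₁ z₀, ← hψ x y₁ z₁]
      ring
    rw [← e]
    refine (sum_mul_sq_le₃ _ _ _ _ _).trans (mul_le_mul_of_nonneg_right ?_ ?_)
    · refine Finset.sum_le_sum fun x _ => Finset.sum_le_sum fun z₀ _ =>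
        Finset.sum_le_sum fun z₁ _ => ?_
      have a0 := mul_nonneg (hw0 z₀) (hw0 z₁)
      have a1 := mul_le_one₀ (hw1 z₀) (hw0 z₁) (hw1 z₁)
      have b0 := mul_nonneg (hφ0 x z₀) (hφ0 x z₁)
      have b1 := mul_le_one₀ (hφ1 x z₀) (hφ0 x z₁) (hφ1 x z₁)
      exact (sq_le _ (mul_nonneg a0 b0) (mul_le_one₀ a1 b0 b1)).trans
        (mul_le_of_le_one_left b0 a1)
    · exact Finset.sum_nonneg fun _ _ => Finset.sum_nonneg fun _ _ =>
        Finset.sum_nonneg fun _ _ => sq_nonneg _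
  have hQO : Q ^ 2 ≤ N₃ * O := by
    have e : ∑ y₀ ∈ Y, ∑ y₁ ∈ Y, ∑ z₀ ∈ Z, ∑ z₁ ∈ Z,
        (∑ x ∈ X, h x y₀ z₀ * h x y₀ z₁ * h x y₁ z₀ * h x y₁ z₁) ^ 2 = O := by
      have e1 : ∀ y₀ y₁ z₀ z₁, (∑ x ∈ X, h x y₀ z₀ * h x y₀ z₁ * h x y₁ z₀ * h x y₁ z₁) ^ 2 =
          ∑ q ∈ X ×ˢ X, h q.1 y₀ z₀ * h q.1 y₀ z₁ * h q.1 y₁ z₀ * h q.1 y₁ z₁ *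
            (h q.2 y₀ z₀ * h q.2 y₀ z₁ * h q.2 y₁ z₀ * h q.2 y₁ z₁) := by
        intro y₀ y₁ z₀ z₁
        rw [sum_sq_eq_sum_sum, Finset.sum_product]
      have e2 : ∀ f : ℕ → ℕ → ℕ → ℕ → ℝ, ∑ y₀ ∈ Y, ∑ y₁ ∈ Y, ∑ z₀ ∈ Z, ∑ z₁ ∈ Z, f y₀ y₁ z₀ z₁ =
          ∑ q ∈ Y ×ˢ Y ×ˢ Z ×ˢ Z, f q.1 q.2.1 q.2.2.1 q.2.2.2 := fun f => by
        simp only [Finset.sum_product]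
      simp only [e1]
      rw [e2 (fun y₀ y₁ z₀ z₁ => ∑ q ∈ X ×ˢ X,
        h q.1 y₀ z₀ * h q.1 y₀ z₁ * h q.1 y₁ z₀ * h q.1 y₁ z₁ *
            (h q.2 y₀ z₀ * h q.2 y₀ z₁ * h q.2 y₁ z₀ * h q.2 y₁ z₁)), Finset.sum_comm]
      simp only [Finset.sum_product, hO]
      refine Finset.sum_congr rfl fun x₀ _ => Finset.sum_congr rfl fun x₁ _ =>
        Finset.sum_congr rfl fun y₀ _ => Finset.sum_congr rfl fun y₁ _ =>
        Finset.sum_congr rfl fun z₀ _ => Finset.sum_congr rfl fun z₁ _ => by ring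
    rw [← e]
    refine (sum_mul_sq_le₄ _ _ _ _ _ _).trans (mul_le_mul_of_nonneg_right ?_ ?_)
    · refine Finset.sum_le_sum fun y₀ _ => Finset.sum_le_sum fun y₁ _ =>
        Finset.sum_le_sum fun z₀ _ => Finset.sum_le_sum fun z₁ _ => ?_
      have a0 := mul_nonneg (hψ0 y₀ z₀) (hψ0 y₀ z₁)
      have a1 := mul_le_one₀ (hψ1 y₀ z₀) (hψ0 y₀ z₁) (hψ1 y₀ z₁)
      have b0 := mul_nonneg a0 (hψ0 y₁ z₀)
      have b1 := mul_le_one₀ a1 (hψ0 y₁ z₀) (hψ1 y₁ z₀)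
      exact sq_le _ (mul_nonneg b0 (hψ0 _ _)) (mul_le_one₀ b1 (hψ0 _ _) (hψ1 _ _))
    · exact Finset.sum_nonneg fun _ _ => Finset.sum_nonneg fun _ _ =>
        Finset.sum_nonneg fun _ _ => Finset.sum_nonneg fun _ _ => sq_nonneg _
  calc S ^ 8 = ((S ^ 2) ^ 2) ^ 2 := by ring
    _ ≤ ((N₁ * T) ^ 2) ^ 2 := by gcongr
    _ = N₁ ^ 4 * (T ^ 2) ^ 2 := by ring
    _ ≤ N₁ ^ 4 * (N₂ * Q) ^ 2 := by gcongr
    _ = N₁ ^ 4 * N₂ ^ 2 * Q ^ 2 := by ring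
    _ ≤ N₁ ^ 4 * N₂ ^ 2 * (N₃ * O) := by gcongr
    _ = _ := by ring

lemma Bigraph.cutSmall_of_devSum_le {B : Bigraph} {κ : ℝ} (hκ : 0 ≤ κ)
    (h : B.devSum ≤ κ ^ 4 * (B.left.card : ℝ) ^ 2 * (B.right.card : ℝ) ^ 2) :
    CutSmall B.left B.right (fun x y => pairInd B.edges x y - B.density) κ := by
  have e : ∀ x y, pairInd B.edges x y - B.density = B.gfun x y := by
    intro x y
    unfold pairInd Bigraph.gfun
    split_ifs <;> ring
  simp only [e]
  exact cutSmall_of_boxSum_le hκ h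

lemma Bigraph.density_le_one (B : Bigraph) : B.density ≤ 1 := by
  unfold Bigraph.density
  refine div_le_one_of_le₀ ?_ (by positivity)
  have := Finset.card_le_card B.edges_sub
  rw [Finset.card_product] at this
  exact_mod_cast this

lemma Bigraph.sum_pairInd_edges (B : Bigraph) :
    ∑ x ∈ B.left, ∑ y ∈ B.right, pairInd B.edges x y =
      B.density * B.left.card * B.right.card := by
  rw [sum_pairInd B.edges_sub, Bigraph.density]
  rcases eq_or_ne ((B.left.card : ℝ) * B.right.card) 0 with h | h
  · have := Finset.card_le_card B.edges_sub
    rw [Finset.card_product] at this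
    have h' : B.left.card * B.right.card = 0 := by exact_mod_cast h
    have h2 : B.edges.card = 0 := by omega
    simp [h2]
  · rw [mul_assoc, div_mul_cancel₀ _ h]

lemma Bigraph.card_pos_of_density_pos {B : Bigraph} (h : 0 < B.density) :
    0 < (B.left.card : ℝ) ∧ 0 < (B.right.card : ℝ) := by
  unfold Bigraph.density at h
  refine ⟨?_, ?_⟩ <;> refine lt_of_le_of_ne (Nat.cast_nonneg _) fun h0 => ?_ <;>
    rw [← h0] at h <;> simp at h

lemma relDensity_nonneg (R : Finset (ℕ × ℕ × ℕ)) (G : Triad) : 0 ≤ relDensity R G := by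
  unfold relDensity; positivity

lemma relDensity_le_one (R : Finset (ℕ × ℕ × ℕ)) (G : Triad) : relDensity R G ≤ 1 := by
  unfold relDensity
  refine div_le_one_of_le₀ ?_ (by positivity)
  exact_mod_cast Finset.card_le_card Finset.inter_subset_right

lemma Triad.mem_K3 {G : Triad} {x y z : ℕ} :
    (x, y, z) ∈ G.K3 ↔ (x, y) ∈ G.EXY ∧ (y, z) ∈ G.EYZ ∧ (x, z) ∈ G.EXZ := by
  unfold Triad.K3
  simp only [Finset.mem_filter, Finset.mem_product]
  refine ⟨fun h => h.2, fun h => ⟨?_, h⟩⟩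
  have h1 := Finset.mem_product.mp (G.hXY h.1)
  have h2 := Finset.mem_product.mp (G.hYZ h.2.1)
  exact ⟨h1.1, h1.2, h2.2⟩

lemma octahedron_bounds_absurd {s δ e₁ e₂ e₃ a b n S N₂ N₃ O : ℝ}
    (hs0 : 0 < s) (hs1 : s ≤ 1 / 2 ^ 50) (hδ : δ ≤ s ^ 33)
    (he₁ : 0 < e₁) (he₂ : 0 < e₂) (he₃ : 0 < e₃) (ha : 0 < a) (hb : 0 < b) (hn : 0 < n)
    (hN₂ : 0 ≤ N₂) (hN₃ : 0 ≤ N₃) (hδ0 : 0 ≤ δ)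
    (hS : s ^ 4 / 16 * (e₁ * e₂ * e₃ * (a * b * n)) ≤ |S|)
    (up : S ^ 8 ≤ (e₁ * a * b) ^ 4 * N₂ ^ 2 * N₃ * O)
    (b2 : N₂ ≤ 2 * e₃ ^ 2 * a * n ^ 2) (b3 : N₃ ≤ 2 * e₂ ^ 4 * b ^ 2 * n ^ 2)
    (bO : O ≤ δ * (2 * e₁) ^ 4 * (2 * e₂) ^ 4 * (2 * e₃) ^ 4 * a ^ 2 * b ^ 2 * n ^ 2) : False := by
  set M := e₁ * e₂ * e₃ * (a * b * n) with hM
  have hM0 : 0 < M := by positivity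
  set K := δ * (2 * e₁) ^ 4 * (2 * e₂) ^ 4 * (2 * e₃) ^ 4 * a ^ 2 * b ^ 2 * n ^ 2 with hK
  have hK0 : 0 ≤ K := by positivity
  have h1 : (s ^ 4 / 16 * M) ^ 8 ≤ S ^ 8 := by
    rw [← Even.pow_abs (n := 8) (by decide) S]
    exact pow_le_pow_left₀ (by positivity) hS 8
  have h2 : (e₁ * a * b) ^ 4 * N₂ ^ 2 * N₃ * O ≤ (e₁ * a * b) ^ 4 * N₂ ^ 2 * N₃ * K :=
    mul_le_mul_of_nonneg_left bO (by positivity)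
  have h3 : N₂ ^ 2 ≤ (2 * e₃ ^ 2 * a * n ^ 2) ^ 2 := pow_le_pow_left₀ hN₂ b2 2
  have h4 : N₂ ^ 2 * N₃ ≤ (2 * e₃ ^ 2 * a * n ^ 2) ^ 2 * (2 * e₂ ^ 4 * b ^ 2 * n ^ 2) :=
    mul_le_mul h3 b3 hN₃ (by positivity)
  have h5 : (e₁ * a * b) ^ 4 * K * (N₂ ^ 2 * N₃) ≤ (e₁ * a * b) ^ 4 * K *
      ((2 * e₃ ^ 2 * a * n ^ 2) ^ 2 * (2 * e₂ ^ 4 * b ^ 2 * n ^ 2)) :=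
    mul_le_mul_of_nonneg_left h4 (by positivity)
  have h6 : (e₁ * a * b) ^ 4 * K *
      ((2 * e₃ ^ 2 * a * n ^ 2) ^ 2 * (2 * e₂ ^ 4 * b ^ 2 * n ^ 2)) = δ * (2 ^ 15 * M ^ 8) := by
    rw [hM, hK]; ring
  have h7 : δ * (2 ^ 15 * M ^ 8) ≤ s ^ 33 * (2 ^ 15 * M ^ 8) :=
    mul_le_mul_of_nonneg_right hδ (by positivity)
  have e1 : (s ^ 4 / 16 * M) ^ 8 = (s ^ 32 * M ^ 8) * (1 / 2 ^ 32) := by ring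
  have e2 : s ^ 33 * (2 ^ 15 * M ^ 8) = (s ^ 32 * M ^ 8) * (s * 2 ^ 15) := by ring
  have hfin : (s ^ 32 * M ^ 8) * (1 / 2 ^ 32) ≤ (s ^ 32 * M ^ 8) * (s * 2 ^ 15) := by
    linarith
  have := le_of_mul_le_mul_left hfin (by positivity)
  norm_num at this hs1
  linarith

/-- In a regular triad, the deviation function cannot be a large constant on the triangles over a
non-negligible set `Q` of pairs and a non-negligible set `Wp` of vertices. -/
lemma Triad.card_le_of_const {R : Finset (ℕ × ℕ × ℕ)} {G : Triad} {s m ρ κ δ η c : ℝ}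
    (hs0 : 0 < s) (hs1 : s ≤ 1 / 2 ^ 50) (hms : m * s ≤ 1) (hρ0 : 0 < ρ) (hρ1 : ρ ≤ 1)
    (hκ : κ = ρ ^ 4 * s ^ 4 / 16) (hδ0 : 0 ≤ δ) (hδ : δ ≤ s ^ 33) (hη : η ≤ κ ^ 4)
    (hdev : dev23 R G δ η) (hXY : ρ ≤ G.bXY.density) (hXZ : ρ ≤ G.bXZ.density)
    (hYZ : ρ ≤ G.bYZ.density) {Wp : Finset ℕ} (hW : Wp ⊆ G.Z)
    (hWc : (G.Z.card : ℝ) ≤ 4 * m * Wp.card) (hc : 1 / 2 ≤ |c|) {Q : Finset (ℕ × ℕ)}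
    (hQ : Q ⊆ G.EXY)
    (hconst : ∀ x y z, (x, y) ∈ Q → z ∈ Wp → (x, y, z) ∈ G.K3 → hFun R G x y z = c) :
    (Q.card : ℝ) ≤ s ^ 3 * G.EXY.card := by
  by_contra! hcon
  obtain ⟨d₁, d₂, d₃, hd₁, hd₂, hd₃, ⟨hd₁', -⟩, ⟨hd₃', hdev₃⟩, ⟨hd₂', hdev₂⟩, hdev⟩ := hdev
  have hκ0 : 0 < κ := by rw [hκ]; positivity
  have hs1' : s ≤ 1 := hs1.trans (by norm_num)
  have hρ4 : ρ ^ 4 ≤ ρ := by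
    have : ρ ^ 4 = ρ * ρ ^ 3 := by ring
    rw [this]; exact mul_le_of_le_one_right hρ0.le (pow_le_one₀ hρ0.le hρ1)
  have hκρ : κ ≤ ρ ^ 4 / 16 := by
    rw [hκ]
    have : s ^ 4 ≤ 1 := pow_le_one₀ hs0.le hs1'
    have : ρ ^ 4 * s ^ 4 ≤ ρ ^ 4 * 1 := by gcongr
    linarith
  have hκ1 : κ ≤ 1 := by linarith
  have hηρ : η ≤ ρ := by
    have : κ ^ 4 = κ * κ ^ 3 := by ring
    have h2 : κ * κ ^ 3 ≤ κ := mul_le_of_le_one_right hκ0.le (pow_le_one₀ hκ0.le hκ1)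
    linarith
  set a := (G.X.card : ℝ) with ha
  set b := (G.Y.card : ℝ) with hb
  set n := (G.Z.card : ℝ) with hn
  set e₁ := G.bXY.density with he₁
  set e₂ := G.bYZ.density with he₂
  set e₃ := G.bXZ.density with he₃
  obtain ⟨ha0, hb0⟩ : 0 < a ∧ 0 < b := Bigraph.card_pos_of_density_pos (hρ0.trans_le hXY)
  obtain ⟨-, hn0⟩ : 0 < b ∧ 0 < n := Bigraph.card_pos_of_density_pos (hρ0.trans_le hYZ)
  have he₁0 : 0 < e₁ := hρ0.trans_le hXY
  have he₂0 : 0 < e₂ := hρ0.trans_le hYZ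
  have he₃0 : 0 < e₃ := hρ0.trans_le hXZ
  have hd₁2 : d₁ ≤ 2 * e₁ := by linarith [(abs_le.mp hd₁').1]
  have hd₂2 : d₂ ≤ 2 * e₂ := by linarith [(abs_le.mp hd₂').1]
  have hd₃2 : d₃ ≤ 2 * e₃ := by linarith [(abs_le.mp hd₃').1]
  have cut₂ : CutSmall G.Y G.Z (fun x y => pairInd G.EYZ x y - e₂) κ :=
    Bigraph.cutSmall_of_devSum_le (B := G.bYZ) hκ0.le (hdev₂.trans (by gcongr))
  have cut₃ : CutSmall G.X G.Z (fun x y => pairInd G.EXZ x y - e₃) κ :=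
    Bigraph.cutSmall_of_devSum_le (B := G.bXZ) hκ0.le (hdev₃.trans (by gcongr))
  set w : ℕ → ℝ := fun z => if z ∈ Wp then 1 else 0 with hw
  have hw0 : ∀ z, 0 ≤ w z := fun z => by simp only [hw]; split_ifs <;> norm_num
  have hw1 : ∀ z, w z ≤ 1 := fun z => by simp only [hw]; split_ifs <;> norm_num
  have hEXY : ∑ x ∈ G.X, ∑ y ∈ G.Y, pairInd G.EXY x y = e₁ * a * b :=
    Bigraph.sum_pairInd_edges G.bXY
  have hEc : (G.EXY.card : ℝ) = e₁ * a * b := by rw [← hEXY, sum_pairInd G.hXY]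
  -- lower bound
  have tri := le_triangles_of_cutSmall cut₃ cut₂ (pairInd_nonneg _) (pairInd_le_one _)
    he₃0.le (Bigraph.density_le_one _) hκ0.le (pairInd_nonneg Q) (pairInd_le_one Q) hw0 hw1
  rw [sum_pairInd (hQ.trans G.hXY)] at tri
  have hwsum : ∑ z ∈ G.Z, w z = Wp.card := by
    simp only [hw, Finset.sum_boole]
    rw [Finset.filter_mem_eq_inter, Finset.inter_eq_right.mpr hW]
  rw [hwsum] at tri
  set N := ∑ x ∈ G.X, ∑ y ∈ G.Y, ∑ z ∈ G.Z,
    pairInd Q x y * w z * (pairInd G.EXZ x z * pairInd G.EYZ y z) with hN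
  set S := ∑ x ∈ G.X, ∑ y ∈ G.Y, ∑ z ∈ G.Z, pairInd Q x y * w z * hFun R G x y z with hS
  have hSN : S = c * N := by
    simp only [hS, hN, Finset.mul_sum]
    refine Finset.sum_congr rfl fun x _ => Finset.sum_congr rfl fun y _ =>
      Finset.sum_congr rfl fun z _ => ?_
    by_cases hq : (x, y) ∈ Q
    swap
    · simp [pairInd, hq]
    by_cases hz : z ∈ Wp
    swap
    · simp [hw, hz]
    by_cases h3 : (x, y, z) ∈ G.K3
    · have h3' := Triad.mem_K3.mp h3
      simp [pairInd, hq, hw, hz, hconst x y z hq hz h3, h3'.2.1, h3'.2.2]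
    · have : hFun R G x y z = 0 := by simp [hFun, h3]
      rw [this]
      rw [Triad.mem_K3] at h3
      have hxy := hQ hq
      by_cases h4 : (y, z) ∈ G.EYZ
      · have h5 : (x, z) ∉ G.EXZ := fun h5 => h3 ⟨hxy, h4, h5⟩
        simp [pairInd, h5]
      · simp [pairInd, h4]
  set M := e₁ * e₂ * e₃ * (a * b * n) with hM
  have hM0 : 0 < M := by positivity
  have hWlow : s * n / 4 ≤ Wp.card := by
    have h1 : s * n ≤ s * (4 * m * Wp.card) := by gcongr
    have h2 : s * (4 * m * Wp.card) = 4 * Wp.card * (m * s) := by ring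
    have h3 : 4 * (Wp.card : ℝ) * (m * s) ≤ 4 * Wp.card * 1 := by gcongr
    linarith
  have hNlow : s ^ 4 / 8 * M ≤ N := by
    have h1 : e₃ * e₂ * (s ^ 3 * (e₁ * a * b)) * (s * n / 4) ≤ e₃ * e₂ * Q.card * Wp.card := by
      rw [hEc] at hcon
      gcongr
    have h2 : 2 * κ * a * b * n ≤ s ^ 4 / 8 * M := by
      have h3 : ρ ^ 4 ≤ e₁ * e₂ * e₃ := by
        calc ρ ^ 4 = ρ * ρ * ρ * ρ := by ring
          _ ≤ ρ * ρ * ρ * 1 := by gcongr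
          _ ≤ e₁ * e₂ * e₃ * 1 := by gcongr
          _ = _ := by ring
      calc 2 * κ * a * b * n = s ^ 4 / 8 * (ρ ^ 4 * (a * b * n)) := by rw [hκ]; ring
        _ ≤ _ := by rw [hM]; gcongr
    have h3 : e₃ * e₂ * (s ^ 3 * (e₁ * a * b)) * (s * n / 4) = 2 * (s ^ 4 / 8 * M) := by
      rw [hM]; ring
    linarith
  have hSlow : s ^ 4 / 16 * M ≤ |S| := by
    rw [hSN, abs_mul]
    have hN0 : 0 ≤ N := le_trans (by positivity) hNlow
    rw [abs_of_nonneg hN0]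
    calc s ^ 4 / 16 * M = 1 / 2 * (s ^ 4 / 8 * M) := by ring
      _ ≤ |c| * N := by gcongr
  -- upper bound
  have up := correlation_pow_eight_le G.X G.Y G.Z (hFun R G) (pairInd G.EXY) (pairInd G.EXZ)
    (pairInd G.EYZ) (pairInd Q) w
    (fun x y z => by
      by_cases h : (x, y) ∈ G.EXY
      · simp [pairInd, h]
      · simp [hFun, Triad.mem_K3, h])
    (fun x y z => by
      by_cases h : (x, z) ∈ G.EXZ
      · simp [pairInd, h]
      · simp [hFun, Triad.mem_K3, h])
    (fun x y z => by
      by_cases h : (y, z) ∈ G.EYZ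
      · simp [pairInd, h]
      · simp [hFun, Triad.mem_K3, h])
    (pairInd_nonneg _) (pairInd_le_one _) (pairInd_nonneg _) (pairInd_le_one _)
    (pairInd_nonneg _) (pairInd_le_one _) (pairInd_nonneg _) (pairInd_le_one _) hw0 hw1
  have c3 := cherry_le_of_cutSmall cut₃ (pairInd_nonneg _) (pairInd_le_one _)
    he₃0.le (Bigraph.density_le_one _) hκ0.le
  have c2 := fourCycle_le_of_cutSmall cut₂ (pairInd_nonneg _) (pairInd_le_one _)
    he₂0.le (Bigraph.density_le_one _) hκ0.le
  rw [hEXY] at up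
  change _ ≤ _ * devSum3 R G at up
  set N₂ := ∑ x ∈ G.X, ∑ z₀ ∈ G.Z, ∑ z₁ ∈ G.Z, pairInd G.EXZ x z₀ * pairInd G.EXZ x z₁ with hN₂
  set N₃ := ∑ y₀ ∈ G.Y, ∑ y₁ ∈ G.Y, ∑ z₀ ∈ G.Z, ∑ z₁ ∈ G.Z, pairInd G.EYZ y₀ z₀ *
    pairInd G.EYZ y₀ z₁ * pairInd G.EYZ y₁ z₀ * pairInd G.EYZ y₁ z₁ with hN₃
  have hN₂0 : 0 ≤ N₂ := Finset.sum_nonneg fun _ _ => Finset.sum_nonneg fun _ _ =>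
    Finset.sum_nonneg fun _ _ => mul_nonneg (pairInd_nonneg _ _ _) (pairInd_nonneg _ _ _)
  have hN₃0 : 0 ≤ N₃ := Finset.sum_nonneg fun _ _ => Finset.sum_nonneg fun _ _ =>
    Finset.sum_nonneg fun _ _ => Finset.sum_nonneg fun _ _ =>
    mul_nonneg (mul_nonneg (mul_nonneg (pairInd_nonneg _ _ _) (pairInd_nonneg _ _ _))
      (pairInd_nonneg _ _ _)) (pairInd_nonneg _ _ _)
  have b2 : N₂ ≤ 2 * e₃ ^ 2 * a * n ^ 2 := by
    refine c3.trans ?_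
    have : ρ ^ 4 ≤ ρ ^ 2 := pow_le_pow_of_le_one hρ0.le hρ1 (by norm_num)
    have : ρ ^ 2 ≤ e₃ ^ 2 := by gcongr
    gcongr
    linarith
  have b3 : N₃ ≤ 2 * e₂ ^ 4 * b ^ 2 * n ^ 2 := by
    refine c2.trans ?_
    have : ρ ^ 4 ≤ e₂ ^ 4 := by gcongr
    gcongr
    linarith
  have bO : devSum3 R G ≤ δ * (2 * e₁) ^ 4 * (2 * e₂) ^ 4 * (2 * e₃) ^ 4 * a ^ 2 *
      b ^ 2 * n ^ 2 := by
    refine hdev.trans ?_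
    gcongr
  exact octahedron_bounds_absurd hs0 hs1 hδ he₁0 he₂0 he₃0 ha0 hb0 hn0 hN₂0 hN₃0 hδ0
    hSlow up b2 b3 bO

/-- If membership in `R` of a triangle over `Wp` depends only on its pair in `X × Y`, through `P₁`,
then `P₁` or its complement is negligible. -/
lemma Triad.minority {R : Finset (ℕ × ℕ × ℕ)} {G : Triad} {s m ρ κ δ η : ℝ}
    (hs0 : 0 < s) (hs1 : s ≤ 1 / 2 ^ 50) (hms : m * s ≤ 1) (hρ0 : 0 < ρ) (hρ1 : ρ ≤ 1)
    (hκ : κ = ρ ^ 4 * s ^ 4 / 16) (hδ0 : 0 ≤ δ) (hδ : δ ≤ s ^ 33) (hη : η ≤ κ ^ 4)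
    (hdev : dev23 R G δ η) (hXY : ρ ≤ G.bXY.density) (hXZ : ρ ≤ G.bXZ.density)
    (hYZ : ρ ≤ G.bYZ.density) {Wp : Finset ℕ} (hW : Wp ⊆ G.Z)
    (hWc : (G.Z.card : ℝ) ≤ 4 * m * Wp.card) (P₁ : ℕ × ℕ → Prop)
    (hR : ∀ x y z, (x, y) ∈ G.EXY → z ∈ Wp → ((x, y, z) ∈ R ↔ P₁ (x, y))) :
    ((G.EXY.filter P₁).card : ℝ) ≤ s ^ 3 * G.EXY.card ∨
      ((G.EXY.filter fun p => ¬ P₁ p).card : ℝ) ≤ s ^ 3 * G.EXY.card := by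
  have h0 := relDensity_nonneg R G
  have h1 := relDensity_le_one R G
  rcases le_total (relDensity R G) (1 / 2) with h | h
  · left
    refine Triad.card_le_of_const hs0 hs1 hms hρ0 hρ1 hκ hδ0 hδ hη hdev hXY hXZ hYZ hW hWc
      (c := 1 - relDensity R G) ?_ (Finset.filter_subset _ _) ?_
    · rw [abs_of_nonneg] <;> linarith
    · intro x y z hq hz h3
      obtain ⟨hq, hp⟩ := Finset.mem_filter.mp hq
      simp [hFun, h3, (hR x y z hq hz).mpr hp]
  · right
    refine Triad.card_le_of_const hs0 hs1 hms hρ0 hρ1 hκ hδ0 hδ hη hdev hXY hXZ hYZ hW hWc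
      (c := - relDensity R G) ?_ (Finset.filter_subset _ _) ?_
    · rw [abs_neg, abs_of_nonneg h0]; exact h
    · intro x y z hq hz h3
      obtain ⟨hq, hp⟩ := Finset.mem_filter.mp hq
      simp [hFun, h3, (hR x y z hq hz).not.mpr hp]

/-- The triple `(x, y, z)` lies in a regular triad of the decomposition. -/
def Decomp.RegTriple {V : Finset ℕ} {ι κ : Type} (P : Decomp V ι κ) (R : Finset (ℕ × ℕ × ℕ))
    (ε₁ ε₂ : ℝ) (p : ℕ × ℕ × ℕ) : Prop :=
  ∃ i j k α β γ, p ∈ (P.triadOf i j k α β γ).K3 ∧ dev23 R (P.triadOf i j k α β γ) ε₁ ε₂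

section Decomp

variable {V : Finset ℕ} {ι κ : Type} (P : Decomp V ι κ)

lemma Decomp.part_eq {i j : ι} {x : ℕ} (hi : x ∈ P.part i) (hj : x ∈ P.part j) : i = j := by
  by_contra h
  exact Finset.disjoint_left.mp (P.part_disj i j h) hi hj

lemma Decomp.pairs_eq {i j : ι} {α β : κ} {p : ℕ × ℕ} (hα : p ∈ P.pairs i j α)
    (hβ : p ∈ P.pairs i j β) : α = β := by
  by_contra h
  exact Finset.disjoint_left.mp (P.pairs_disj i j α β h) hα hβ

lemma Decomp.RegTriple.of_pair {P : Decomp V ι κ} {R : Finset (ℕ × ℕ × ℕ)} {ε₁ ε₂ : ℝ}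
    {i j : ι} {α : κ} {x y z : ℕ} (h : P.RegTriple R ε₁ ε₂ (x, y, z))
    (hxy : (x, y) ∈ P.pairs i j α) :
    ∃ k β γ, (x, z) ∈ P.pairs i k β ∧ (y, z) ∈ P.pairs j k γ ∧
      dev23 R (P.triadOf i j k α β γ) ε₁ ε₂ := by
  obtain ⟨i', j', k, α', β, γ, h3, hd⟩ := h
  rw [Triad.mem_K3] at h3
  obtain ⟨h1, h2, h3⟩ := h3
  have a := Finset.mem_product.mp (P.pairs_sub _ _ _ h1)
  have b := Finset.mem_product.mp (P.pairs_sub _ _ _ hxy)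
  obtain rfl := P.part_eq a.1 b.1
  obtain rfl := P.part_eq a.2 b.2
  obtain rfl := P.pairs_eq h1 hxy
  exact ⟨k, β, γ, h3, h2, hd⟩

lemma Decomp.sum_card_part_le {K : Finset ι} {C : Finset ℕ} (hK : ∀ k ∈ K, P.part k ⊆ C) :
    ∑ k ∈ K, ((P.part k).card : ℝ) ≤ C.card := by
  rw [← Nat.cast_sum, ← Finset.card_biUnion fun i _ j _ h => P.part_disj i j h]
  exact_mod_cast Finset.card_le_card (Finset.biUnion_subset.mpr hK)

lemma Decomp.sum_card_part_eq {K : Finset ι} {C : Finset ℕ} (hK : ∀ k ∈ K, P.part k ⊆ C)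
    (hC : ∀ x ∈ C, ∃ k ∈ K, x ∈ P.part k) : ∑ k ∈ K, ((P.part k).card : ℝ) = C.card := by
  rw [← Nat.cast_sum, ← Finset.card_biUnion fun i _ j _ h => P.part_disj i j h]
  congr 2
  exact (Finset.biUnion_subset.mpr hK).antisymm fun x hx => Finset.mem_biUnion.mpr (hC x hx)

lemma Decomp.card_pairs_eq (i j : ι) (α : κ) : ((P.pairs i j α).card : ℝ) =
    (P.pairBG i j α).density * (P.part i).card * (P.part j).card := by
  exact (sum_pairInd (P.pairs_sub i j α)).symm.trans (P.pairBG i j α).sum_pairInd_edges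

lemma Decomp.sum_card_pairs_eq [Fintype κ] (i j : ι) :
    ∑ α, ((P.pairs i j α).card : ℝ) = (P.part i).card * (P.part j).card := by
  rw [← Nat.cast_sum, ← Finset.card_biUnion fun α _ β _ h => P.pairs_disj i j α β h,
    ← Nat.cast_mul, ← Finset.card_product]
  congr 2
  ext p
  simp only [Finset.mem_biUnion, Finset.mem_univ, true_and]
  exact ⟨fun ⟨α, h⟩ => P.pairs_sub i j α h, fun h => P.pairs_cover i j p h⟩

/-- Few pairs lie in sparse pieces between a fixed part and the parts indexed by `K`. -/
lemma Decomp.card_sparse_le [Fintype κ] {K : Finset ι} {C : Finset ℕ}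
    (hK : ∀ k ∈ K, P.part k ⊆ C) (i : ι) {ρ : ℝ} (hρ : 0 ≤ ρ) :
    ((((K ×ˢ (Finset.univ : Finset κ)).filter fun q => (P.pairBG i q.1 q.2).density < ρ).biUnion
      fun q => P.pairs i q.1 q.2).card : ℝ) ≤
        Fintype.card κ * ρ * (P.part i).card * C.card := by
  have h1 : ∀ q ∈ (K ×ˢ (Finset.univ : Finset κ)).filter
      (fun q => (P.pairBG i q.1 q.2).density < ρ),
      ((P.pairs i q.1 q.2).card : ℝ) ≤ ρ * (P.part i).card * (P.part q.1).card := by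
    intro q hq
    rw [P.card_pairs_eq]
    have := (Finset.mem_filter.mp hq).2.le
    gcongr
  calc _ ≤ ∑ q ∈ (K ×ˢ (Finset.univ : Finset κ)).filter
        (fun q => (P.pairBG i q.1 q.2).density < ρ), ((P.pairs i q.1 q.2).card : ℝ) := by
        exact_mod_cast Finset.card_biUnion_le
    _ ≤ ∑ q ∈ (K ×ˢ (Finset.univ : Finset κ)).filter
        (fun q => (P.pairBG i q.1 q.2).density < ρ),
          ρ * (P.part i).card * (P.part q.1).card := Finset.sum_le_sum h1
    _ ≤ ∑ q ∈ K ×ˢ (Finset.univ : Finset κ), ρ * (P.part i).card * (P.part q.1).card :=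
        Finset.sum_le_sum_of_subset_of_nonneg (Finset.filter_subset _ _)
          fun _ _ _ => by positivity
    _ = Fintype.card κ * ρ * (P.part i).card * ∑ k ∈ K, ((P.part k).card : ℝ) := by
        rw [Finset.sum_product, Finset.mul_sum]
        refine Finset.sum_congr rfl fun k _ => ?_
        simp only [Finset.sum_const, Finset.card_univ, nsmul_eq_mul]
        ring
    _ ≤ _ := by
        gcongr
        exact P.sum_card_part_le hK

/-- If most triples over a dense piece and a large vertex class are regular, then some regular
triad on that piece has dense sides and a third part meeting the class substantially. -/
lemma Decomp.exists_regular_triad [Fintype κ] {R : Finset (ℕ × ℕ × ℕ)} {ε₁ ε₂ θ ρ m : ℝ}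
    {i j : ι} {α : κ} {K : Finset ι} {C D : Finset ℕ} (hK : ∀ k ∈ K, P.part k ⊆ C)
    (hD : ∀ z ∈ D, ∃ k ∈ K, z ∈ P.part k) (hm : 0 < m) (hCD : (C.card : ℝ) = m * D.card)
    (hD0 : 0 < (D.card : ℝ)) (hα0 : 0 < ((P.pairs i j α).card : ℝ))
    (hθ : θ * (P.part i).card * (P.part j).card ≤ (P.pairs i j α).card) (hρ0 : 0 ≤ ρ)
    (hρ : 5 * Fintype.card κ * ρ * m ≤ θ)
    (hbad : (((P.pairs i j α ×ˢ D).filter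
      fun p => ¬ P.RegTriple R ε₁ ε₂ (p.1.1, p.1.2, p.2)).card : ℝ) ≤
        1 / 4 * ((P.pairs i j α).card * D.card)) :
    ∃ k β γ, dev23 R (P.triadOf i j k α β γ) ε₁ ε₂ ∧ ρ ≤ (P.pairBG i k β).density ∧
      ρ ≤ (P.pairBG j k γ).density ∧
      ((P.part k).card : ℝ) ≤ 4 * m * (D ∩ P.part k).card := by
  by_contra! hcon
  set E := P.pairs i j α with hE
  set S₁ := (E ×ˢ D).filter fun p => ¬ P.RegTriple R ε₁ ε₂ (p.1.1, p.1.2, p.2) with hS₁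
  set L := (K.filter fun k => 4 * m * (D ∩ P.part k).card < ((P.part k).card : ℝ)).biUnion
    fun k => D ∩ P.part k with hL
  set T₃ := ((K ×ˢ (Finset.univ : Finset κ)).filter
    fun q => (P.pairBG i q.1 q.2).density < ρ).biUnion fun q => P.pairs i q.1 q.2 with hT₃
  set T₄ := ((K ×ˢ (Finset.univ : Finset κ)).filter
    fun q => (P.pairBG j q.1 q.2).density < ρ).biUnion fun q => P.pairs j q.1 q.2 with hT₄
  set S₃ := (P.part j ×ˢ T₃).image fun q => ((q.2.1, q.1), q.2.2) with hS₃
  set S₄ := (P.part i ×ˢ T₄).image fun q => ((q.1, q.2.1), q.2.2) with hS₄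
  have hsub : E ×ˢ D ⊆ S₁ ∪ (E ×ˢ L) ∪ S₃ ∪ S₄ := by
    rintro ⟨⟨x, y⟩, z⟩ hp
    obtain ⟨hxy, hz⟩ := Finset.mem_product.mp hp
    by_cases hreg : P.RegTriple R ε₁ ε₂ (x, y, z)
    swap
    · simp [hS₁, hp, hreg]
    obtain ⟨k, β, γ, hxz, hyz, hdev⟩ := hreg.of_pair hxy
    have hxz' := Finset.mem_product.mp (P.pairs_sub _ _ _ hxz)
    have hyz' := Finset.mem_product.mp (P.pairs_sub _ _ _ hyz)
    have hkK : k ∈ K := by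
      obtain ⟨k', hk', hz'⟩ := hD z hz
      exact P.part_eq hz' hxz'.2 ▸ hk'
    simp only [Finset.mem_union]
    by_cases hβ : ρ ≤ (P.pairBG i k β).density
    swap
    · refine Or.inl (Or.inr (Finset.mem_image.mpr ⟨(y, (x, z)), ?_, rfl⟩))
      refine Finset.mem_product.mpr ⟨hyz'.1, Finset.mem_biUnion.mpr ⟨(k, β), ?_, hxz⟩⟩
      simpa [hkK] using hβ
    by_cases hγ : ρ ≤ (P.pairBG j k γ).density
    swap
    · refine Or.inr (Finset.mem_image.mpr ⟨(x, (y, z)), ?_, rfl⟩)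
      refine Finset.mem_product.mpr ⟨hxz'.1, Finset.mem_biUnion.mpr ⟨(k, γ), ?_, hyz⟩⟩
      simpa [hkK] using hγ
    have hlt := hcon k β γ hdev hβ hγ
    refine Or.inl (Or.inl (Or.inr (Finset.mem_product.mpr ⟨hxy, Finset.mem_biUnion.mpr
      ⟨k, Finset.mem_filter.mpr ⟨hkK, hlt⟩, Finset.mem_inter.mpr ⟨hz, hxz'.2⟩⟩⟩)))
  have hcard : ((E ×ˢ D).card : ℝ) ≤ S₁.card + (E ×ˢ L).card + S₃.card + S₄.card := by
    have h1 := Finset.card_le_card hsub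
    have h2 := Finset.card_union_le (S₁ ∪ (E ×ˢ L) ∪ S₃) S₄
    have h3 := Finset.card_union_le (S₁ ∪ (E ×ˢ L)) S₃
    have h4 := Finset.card_union_le S₁ (E ×ˢ L)
    exact_mod_cast (by omega : (E ×ˢ D).card ≤ S₁.card + (E ×ˢ L).card + S₃.card + S₄.card)
  have hLc : (L.card : ℝ) ≤ 1 / 4 * D.card := by
    have h1 : (L.card : ℝ) ≤ ∑ k ∈ K.filter fun k => 4 * m * (D ∩ P.part k).card <
        ((P.part k).card : ℝ), ((D ∩ P.part k).card : ℝ) := by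
      exact_mod_cast Finset.card_biUnion_le
    have h2 : ∑ k ∈ K.filter (fun k => 4 * m * (D ∩ P.part k).card <
        ((P.part k).card : ℝ)), 4 * m * ((D ∩ P.part k).card : ℝ) ≤ C.card := by
      refine le_trans (Finset.sum_le_sum fun k hk => (Finset.mem_filter.mp hk).2.le) ?_
      exact P.sum_card_part_le fun k hk => hK k (Finset.mem_filter.mp hk).1
    rw [← Finset.mul_sum, hCD] at h2
    have h3 : 4 * m * (L.card : ℝ) ≤ m * D.card :=
      (mul_le_mul_of_nonneg_left h1 (by positivity)).trans h2
    have h4 : m * (4 * (L.card : ℝ)) ≤ m * D.card := by linarith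
    linarith [le_of_mul_le_mul_left h4 hm]
  have hsp : ∀ a b : ℝ, a * b = ((P.part i).card : ℝ) * (P.part j).card →
      a * (Fintype.card κ * ρ * b * C.card) ≤ 1 / 5 * (E.card * D.card) := by
    intro a b hab
    have h1 : 5 * (Fintype.card κ) * ρ * m * ((P.part i).card * (P.part j).card) ≤ E.card := by
      refine le_trans ?_ hθ
      rw [mul_assoc θ]
      gcongr
    have h2 := mul_le_mul_of_nonneg_right h1 hD0.le
    rw [hCD]
    have h3 : a * (Fintype.card κ * ρ * b * (m * D.card)) =
      1 / 5 * (5 * (Fintype.card κ) * ρ * m * (a * b) * D.card) := by ring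
    rw [h3, hab]
    linarith
  have hS₃c : (S₃.card : ℝ) ≤ 1 / 5 * (E.card * D.card) := by
    calc (S₃.card : ℝ) ≤ ((P.part j ×ˢ T₃).card : ℝ) := by exact_mod_cast Finset.card_image_le
      _ = (P.part j).card * (T₃.card : ℝ) := by rw [Finset.card_product]; push_cast; ring
      _ ≤ (P.part j).card * (Fintype.card κ * ρ * (P.part i).card * C.card) := by
          gcongr
          exact P.card_sparse_le hK i hρ0
      _ ≤ _ := hsp _ _ (mul_comm _ _)
  have hS₄c : (S₄.card : ℝ) ≤ 1 / 5 * (E.card * D.card) := by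
    calc (S₄.card : ℝ) ≤ ((P.part i ×ˢ T₄).card : ℝ) := by exact_mod_cast Finset.card_image_le
      _ = (P.part i).card * (T₄.card : ℝ) := by rw [Finset.card_product]; push_cast; ring
      _ ≤ (P.part i).card * (Fintype.card κ * ρ * (P.part j).card * C.card) := by
          gcongr
          exact P.card_sparse_le hK j hρ0
      _ ≤ _ := hsp _ _ rfl
  rw [Finset.card_product, Finset.card_product] at hcard
  push_cast at hcard
  have hpos : 0 < (E.card : ℝ) * D.card := mul_pos hα0 hD0
  have hEL : (E.card : ℝ) * L.card ≤ E.card * (1 / 4 * D.card) := by gcongr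
  linarith

end Decomp

lemma sum_filter_ge {ι : Type*} (I : Finset ι) (a : ι → ℝ) {n c : ℝ} (hc : 0 ≤ c)
    (hsum : ∑ i ∈ I, a i = n) : n - I.card * c ≤ ∑ i ∈ I.filter (fun i => c ≤ a i), a i := by
  have h1 := Finset.sum_filter_add_sum_filter_not I (fun i => c ≤ a i) a
  have h2 : ∑ i ∈ I.filter (fun i => ¬ c ≤ a i), a i ≤ I.card * c := by
    calc _ ≤ ∑ i ∈ I.filter (fun i => ¬ c ≤ a i), c :=
          Finset.sum_le_sum fun i hi => (not_le.mp (Finset.mem_filter.mp hi).2).le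
      _ = (I.filter (fun i => ¬ c ≤ a i)).card * c := by simp
      _ ≤ _ := by
        gcongr
        exact Finset.filter_subset _ _
  linarith

lemma exists_large_pair {t : ℕ} (ht : 1 ≤ t) {a b : Fin t → ℝ} {B : Fin t → Fin t → ℝ} {n δ : ℝ}
    (hn : 0 < n) (hδ0 : 0 < δ) (hδ1 : δ ≤ 1 / 4) (hB : ∀ i j, 0 ≤ B i j)
    (ha1 : ∑ i, a i = n) (hb1 : ∑ j, b j = n)
    (hB1 : ∑ i, ∑ j, B i j ≤ 27 * δ * n ^ 3) :
    ∃ i j, δ * n / (3 * t) ≤ a i ∧ δ * n / (3 * t) ≤ b j ∧ B i j ≤ 54 * δ * (a i * b j) * n := by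
  by_contra! hcon
  have ht0 : (0 : ℝ) < t := by exact_mod_cast ht
  set c := δ * n / (3 * t) with hc
  have hc0 : 0 < c := by positivity
  have htc : (t : ℝ) * c = δ * n / 3 := by rw [hc]; field_simp
  have hδn : δ * n ≤ 1 / 4 * n := by gcongr
  have hA : 3 / 4 * n ≤ ∑ i ∈ Finset.univ.filter (fun i => c ≤ a i), a i := by
    have := sum_filter_ge Finset.univ a hc0.le ha1
    rw [Finset.card_univ, Fintype.card_fin, htc] at this
    linarith
  have hB' : 3 / 4 * n ≤ ∑ i ∈ Finset.univ.filter (fun i => c ≤ b i), b i := by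
    have := sum_filter_ge Finset.univ b hc0.le hb1
    rw [Finset.card_univ, Fintype.card_fin, htc] at this
    linarith
  have h1 : 54 * δ * n * ((3 / 4 * n) * (3 / 4 * n)) ≤ ∑ i, ∑ j, B i j := by
    calc 54 * δ * n * ((3 / 4 * n) * (3 / 4 * n))
        ≤ 54 * δ * n * ((∑ i ∈ Finset.univ.filter (fun i => c ≤ a i), a i) *
            ∑ i ∈ Finset.univ.filter (fun i => c ≤ b i), b i) := by
          have := (by positivity : 0 ≤ 3 / 4 * n).trans hA
          gcongr
      _ = ∑ i ∈ Finset.univ.filter (fun i => c ≤ a i),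
            ∑ j ∈ Finset.univ.filter (fun i => c ≤ b i), 54 * δ * (a i * b j) * n := by
          rw [Finset.sum_mul_sum, Finset.mul_sum]
          refine Finset.sum_congr rfl fun i _ => ?_
          rw [Finset.mul_sum]
          exact Finset.sum_congr rfl fun j _ => by ring
      _ ≤ ∑ i ∈ Finset.univ.filter (fun i => c ≤ a i),
            ∑ j ∈ Finset.univ.filter (fun i => c ≤ b i), B i j :=
          Finset.sum_le_sum fun i hi => Finset.sum_le_sum fun j hj =>
            (hcon i j (Finset.mem_filter.mp hi).2 (Finset.mem_filter.mp hj).2).le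
      _ ≤ ∑ i ∈ Finset.univ.filter (fun i => c ≤ a i), ∑ j, B i j :=
          Finset.sum_le_sum fun i _ => Finset.sum_le_sum_of_subset_of_nonneg
            (Finset.filter_subset _ _) fun _ _ _ => hB _ _
      _ ≤ _ := Finset.sum_le_sum_of_subset_of_nonneg
            (Finset.filter_subset _ _) fun _ _ _ => Finset.sum_nonneg fun _ _ => hB _ _
  have hpos : 0 < δ * n ^ 3 := by positivity
  nlinarith

lemma sum_dense_good_ge {κ : Type*} [Fintype κ] [Nonempty κ] {p B : κ → ℝ} {T n q : ℝ}
    (hn : 0 < n) (hq0 : 0 < q) (hq1 : q ≤ 1 / 100) (hT : 0 ≤ T)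
    (hB : ∀ α, 0 ≤ B α) (hpT : ∑ α, p α = T) (hBT : ∑ α, B α ≤ 54 * q ^ 4 * T * n) :
    (1 - q) * T ≤ ∑ α ∈ Finset.univ.filter
      (fun α => q ^ 4 / Fintype.card κ * T ≤ p α ∧ B α ≤ q ^ 2 * p α * n), p α := by
  have hcard : (0 : ℝ) < Fintype.card κ := by exact_mod_cast Fintype.card_pos
  have h1 := Finset.sum_filter_add_sum_filter_not Finset.univ
    (fun α => q ^ 4 / Fintype.card κ * T ≤ p α ∧ B α ≤ q ^ 2 * p α * n) p
  have h2 : ∑ α ∈ Finset.univ.filter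
      (fun α => ¬ (q ^ 4 / Fintype.card κ * T ≤ p α ∧ B α ≤ q ^ 2 * p α * n)), p α ≤
      ∑ α : κ, (q ^ 4 / Fintype.card κ * T + B α / (q ^ 2 * n)) := by
    have h3 : ∀ α : κ, 0 ≤ q ^ 4 / Fintype.card κ * T := fun _ => by positivity
    have h4 : ∀ α : κ, 0 ≤ B α / (q ^ 2 * n) := fun α => div_nonneg (hB α) (by positivity)
    refine le_trans (Finset.sum_le_sum fun α hα => ?_)
      (Finset.sum_le_sum_of_subset_of_nonneg (Finset.filter_subset _ _)
        fun α _ _ => add_nonneg (h3 α) (h4 α))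
    have := (Finset.mem_filter.mp hα).2
    rw [not_and_or, not_le, not_le] at this
    rcases this with h | h
    · linarith [h4 α]
    · have : p α ≤ B α / (q ^ 2 * n) := by
        rw [le_div_iff₀ (by positivity)]
        linarith
      linarith [h3 α]
  have h5 : ∑ α : κ, (q ^ 4 / Fintype.card κ * T + B α / (q ^ 2 * n)) ≤
      q ^ 4 * T + 54 * q ^ 2 * T := by
    rw [Finset.sum_add_distrib, ← Finset.sum_div, Finset.sum_const, Finset.card_univ, nsmul_eq_mul]
    have e1 : (Fintype.card κ : ℝ) * (q ^ 4 / Fintype.card κ * T) = q ^ 4 * T := by field_simp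
    have e2 : (∑ α, B α) / (q ^ 2 * n) ≤ 54 * q ^ 2 * T := by
      rw [div_le_iff₀ (by positivity)]
      calc _ ≤ _ := hBT
        _ = _ := by ring
    linarith
  have h6 : q ^ 4 + 54 * q ^ 2 ≤ q := by
    have : q ^ 4 ≤ q ^ 2 := pow_le_pow_of_le_one hq0.le (by linarith) (by norm_num)
    nlinarith
  have h7 := mul_le_mul_of_nonneg_right h6 hT
  linarith

section Blowup

variable {G : Bigraph} {n : ℕ} {Γ : BipColored G.left} {Cfam : ℕ → Finset ℕ} {H : ThreeGraph}

lemma IsBlowupWith.disjoint_biUnion (h : IsBlowupWith G n Γ Cfam H) :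
    Disjoint (Γ.A ∪ Γ.B) (G.right.biUnion Cfam) := by
  rw [Finset.disjoint_biUnion_right]
  exact fun v hv => (h.2.2.1 v hv).symm

lemma IsBlowupWith.card_biUnion (h : IsBlowupWith G n Γ Cfam H) :
    (G.right.biUnion Cfam).card = G.right.card * n := by
  rw [Finset.card_biUnion h.2.1, Finset.sum_congr rfl h.1, Finset.sum_const, smul_eq_mul]

lemma IsBlowupWith.card_verts (h : IsBlowupWith G n Γ Cfam H) :
    H.verts.card = Γ.A.card + Γ.B.card + G.right.card * n := by
  rw [h.2.2.2.1, Finset.card_union_of_disjoint h.disjoint_biUnion,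
    Finset.card_union_of_disjoint Γ.disjAB, h.card_biUnion]

lemma BipColored.exists_color {U : Finset ℕ} (Γ : BipColored U) {p : ℕ × ℕ}
    (hp : p ∈ Γ.A ×ˢ Γ.B) : ∃ u ∈ U, p ∈ (Γ.colorBG u).edges := by
  have : ({p.1, p.2} : Finset ℕ) ∈ U.biUnion Γ.P := by
    rw [Γ.P_cover]
    exact Finset.mem_image.mpr ⟨p, hp, rfl⟩
  obtain ⟨u, hu, h⟩ := Finset.mem_biUnion.mp this
  exact ⟨u, hu, Finset.mem_filter.mpr ⟨hp, h⟩⟩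

/-- The pair `p` has a color adjacent to `v`. -/
def BipColored.ColorAdj (Γ : BipColored G.left) (v : ℕ) (p : ℕ × ℕ) : Prop :=
  ∃ u ∈ G.leftNbhd v, p ∈ (Γ.colorBG u).edges

lemma BipColored.exists_color_of_not_colorAdj (Γ : BipColored G.left) {v : ℕ} {p : ℕ × ℕ}
    (hp : p ∈ Γ.A ×ˢ Γ.B) (h : ¬ Γ.ColorAdj v p) :
    ∃ u ∈ G.left \ G.leftNbhd v, p ∈ (Γ.colorBG u).edges := by
  obtain ⟨u, hu, hpu⟩ := Γ.exists_color hp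
  exact ⟨u, Finset.mem_sdiff.mpr ⟨hu, fun h' => h ⟨u, h', hpu⟩⟩, hpu⟩

lemma IsBlowupWith.mem_obar_iff (h : IsBlowupWith G n Γ Cfam H) {v x y z : ℕ} (hv : v ∈ G.right)
    (hxy : (x, y) ∈ Γ.A ×ˢ Γ.B) (hz : z ∈ Cfam v) :
    (x, y, z) ∈ H.obar ↔ Γ.ColorAdj v (x, y) := by
  have hxyz : ({x, y, z} : Finset ℕ) = insert z {x, y} := by
    ext a; simp only [Finset.mem_insert, Finset.mem_singleton]; tauto
  have hx := (Finset.mem_product.mp hxy).1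
  have hy := (Finset.mem_product.mp hxy).2
  have hmem : (x, y, z) ∈ H.verts ×ˢ H.verts ×ˢ H.verts := by
    have : z ∈ G.right.biUnion Cfam := Finset.mem_biUnion.mpr ⟨v, hv, hz⟩
    simp only [Finset.mem_product, h.2.2.2.1, Finset.mem_union]
    exact ⟨Or.inl (Or.inl hx), Or.inl (Or.inr hy), Or.inr this⟩
  have hiff : (x, y, z) ∈ H.obar ↔ insert z ({x, y} : Finset ℕ) ∈ H.edges := by
    rw [← hxyz]
    exact ⟨fun h => (Finset.mem_filter.mp h).2, fun h => Finset.mem_filter.mpr ⟨hmem, h⟩⟩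
  rw [hiff]
  refine ⟨fun he => ?_, fun ⟨u, hu, hpu⟩ => ?_⟩
  · by_contra hna
    obtain ⟨u, hu, hpu⟩ := Γ.exists_color_of_not_colorAdj hxy hna
    obtain ⟨hu, hu'⟩ := Finset.mem_sdiff.mp hu
    refine (h.2.2.2.2 u hu v hv _ (Finset.mem_filter.mp hpu).2 z hz).2 (fun huv => hu' ?_) he
    exact Finset.mem_filter.mpr ⟨hu, huv⟩
  · obtain ⟨hu, huv⟩ := Finset.mem_filter.mp hu
    exact (h.2.2.2.2 u hu v hv _ (Finset.mem_filter.mp hpu).2 z hz).1 huv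

end Blowup

/-- Irregular triples over the parts indexed by `Fin t`, summed over pairs of parts, number at most
the irregular triples of the whole decomposition. -/
lemma Decomp.sum_irregular_le {V : Finset ℕ} {ι κ : Type} {t : ℕ} (P : Decomp V ι κ)
    {R : Finset (ℕ × ℕ × ℕ)} {ε₁ ε₂ : ℝ} (hreg : P.regWrt R ε₁ ε₂) {e f : Fin t → ι}
    (he : Function.Injective e) (hf : Function.Injective f) {C : Finset ℕ} (hC : C ⊆ V) :
    ∑ i, ∑ j, ((((P.part (e i) ×ˢ P.part (f j)) ×ˢ C).filter
      fun p => ¬ P.RegTriple R ε₁ ε₂ (p.1.1, p.1.2, p.2)).card : ℝ) ≤ ε₁ * (V.card : ℝ) ^ 3 := by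
  set B : Fin t × Fin t → Finset ((ℕ × ℕ) × ℕ) := fun q =>
    ((P.part (e q.1) ×ˢ P.part (f q.2)) ×ˢ C).filter
      fun p => ¬ P.RegTriple R ε₁ ε₂ (p.1.1, p.1.2, p.2) with hB
  have hdisj : ∀ q ∈ (Finset.univ : Finset (Fin t × Fin t)), ∀ q' ∈ Finset.univ, q ≠ q' →
      Disjoint (B q) (B q') := by
    intro q _ q' _ hqq
    refine Finset.disjoint_left.mpr fun p hp hp' => hqq ?_
    simp only [hB, Finset.mem_filter, Finset.mem_product] at hp hp'
    exact Prod.ext (he (P.part_eq hp.1.1.1 hp'.1.1.1)) (hf (P.part_eq hp.1.1.2 hp'.1.1.2))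
  have h1 : ((Finset.univ.biUnion B).card : ℝ) ≤
      (((V ×ˢ V ×ˢ V).filter fun p => ¬ P.RegTriple R ε₁ ε₂ p).card : ℝ) := by
    norm_cast
    refine Finset.card_le_card_of_injOn (fun p => (p.1.1, p.1.2, p.2)) ?_ ?_
    · intro p hp
      obtain ⟨q, -, hp⟩ := Finset.mem_biUnion.mp hp
      simp only [hB, Finset.mem_filter, Finset.mem_product] at hp
      simp only [Finset.coe_filter, Set.mem_ofPred_eq, Finset.mem_product]
      exact ⟨⟨P.part_sub _ hp.1.1.1, P.part_sub _ hp.1.1.2, hC hp.1.2⟩, hp.2⟩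
    · rintro ⟨⟨x, y⟩, z⟩ - ⟨⟨x', y'⟩, z'⟩ - h
      simp only [Prod.mk.injEq] at h
      simp [h.1, h.2.1, h.2.2]
  have h2 : (((V ×ˢ V ×ˢ V).filter fun p => P.RegTriple R ε₁ ε₂ p).card : ℝ) +
      ((V ×ˢ V ×ˢ V).filter fun p => ¬ P.RegTriple R ε₁ ε₂ p).card = (V.card : ℝ) ^ 3 := by
    rw [← Nat.cast_add, Finset.card_filter_add_card_filter_not]
    simp only [Finset.card_product]
    push_cast
    ring
  have h3 : (1 - ε₁) * (V.card : ℝ) ^ 3 ≤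
      (((V ×ˢ V ×ˢ V).filter fun p => P.RegTriple R ε₁ ε₂ p).card : ℝ) := hreg
  rw [Finset.card_biUnion hdisj] at h1
  push_cast at h1
  rw [Fintype.sum_prod_type] at h1
  linarith

lemma Decomp.sum_irregular_pairs_le {V : Finset ℕ} {ι κ : Type} [Fintype κ] (P : Decomp V ι κ)
    (i j : ι) (C : Finset ℕ) (Q : (ℕ × ℕ) × ℕ → Prop)
    [DecidablePred Q] :
    ∑ α, (((P.pairs i j α ×ˢ C).filter Q).card : ℝ) ≤
      ((((P.part i ×ˢ P.part j) ×ˢ C).filter Q).card : ℝ) := by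
  rw [← Nat.cast_sum, ← Finset.card_biUnion]
  · refine Nat.cast_le.mpr (Finset.card_le_card (Finset.biUnion_subset.mpr fun α _ => ?_))
    exact Finset.filter_subset_filter _ (Finset.product_subset_product_left (P.pairs_sub i j α))
  · intro α _ β _ h
    refine Finset.disjoint_left.mpr fun p hp hp' => h ?_
    simp only [Finset.mem_filter, Finset.mem_product] at hp hp'
    exact P.pairs_eq hp.1.1 hp'.1.1

/-- If each of the `m` properties `Q v` fails on at most `τ|E|` members of `E`, then all hold
simultaneously outside at most `mτ|E|` members. -/
lemma card_filter_forall_ge {β : Type*} (E : Finset β) (I : Finset ℕ) (Q : ℕ → β → Prop)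
    [∀ v, DecidablePred (Q v)] {τ : ℝ}
    (h : ∀ v ∈ I, ((E.filter fun p => ¬ Q v p).card : ℝ) ≤ τ * E.card) :
    (1 - I.card * τ) * E.card ≤ ((E.filter fun p => ∀ v ∈ I, Q v p).card : ℝ) := by
  have h1 : ((E.filter fun p => ∀ v ∈ I, Q v p).card : ℝ) +
      (E.filter fun p => ¬ ∀ v ∈ I, Q v p).card = E.card := by
    rw [← Nat.cast_add, Finset.card_filter_add_card_filter_not]
  have h2 : ((E.filter fun p => ¬ ∀ v ∈ I, Q v p).card : ℝ) ≤ I.card * (τ * E.card) := by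
    have hsub : (E.filter fun p => ¬ ∀ v ∈ I, Q v p) ⊆
        I.biUnion fun v => E.filter fun p => ¬ Q v p := by
      intro p hp
      obtain ⟨hp, hn⟩ := Finset.mem_filter.mp hp
      push Not at hn
      obtain ⟨v, hv, hq⟩ := hn
      exact Finset.mem_biUnion.mpr ⟨v, hv, Finset.mem_filter.mpr ⟨hp, hq⟩⟩
    calc _ ≤ ((I.biUnion fun v => E.filter fun p => ¬ Q v p).card : ℝ) := by
          exact_mod_cast Finset.card_le_card hsub
      _ ≤ ∑ v ∈ I, ((E.filter fun p => ¬ Q v p).card : ℝ) := by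
          exact_mod_cast Finset.card_biUnion_le
      _ ≤ ∑ v ∈ I, τ * E.card := Finset.sum_le_sum h
      _ = _ := by simp
  linarith

/-- A decomposition refining a tripartition restricts to a partition of each class. -/
lemma Decomp.tripartite_cover {V A B C : Finset ℕ} {ι₁ ι₂ ι₃ κ : Type}
    (P : Decomp V (ι₁ ⊕ ι₂ ⊕ ι₃) κ) (hV : V = A ∪ B ∪ C) (hAB : Disjoint A B)
    (hAC : Disjoint A C) (hBC : Disjoint B C) (hPA : ∀ i, P.part (Sum.inl i) ⊆ A)
    (hPB : ∀ i, P.part (Sum.inr (Sum.inl i)) ⊆ B) (hPC : ∀ i, P.part (Sum.inr (Sum.inr i)) ⊆ C) :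
    (∀ x ∈ A, ∃ i, x ∈ P.part (Sum.inl i)) ∧ (∀ x ∈ B, ∃ i, x ∈ P.part (Sum.inr (Sum.inl i))) ∧
      ∀ x ∈ C, ∃ i, x ∈ P.part (Sum.inr (Sum.inr i)) := by
  have hcov : ∀ x ∈ A ∪ B ∪ C, (∃ i, x ∈ P.part (Sum.inl i)) ∨
      (∃ j, x ∈ P.part (Sum.inr (Sum.inl j))) ∨ ∃ k, x ∈ P.part (Sum.inr (Sum.inr k)) := by
    intro x hx
    obtain ⟨i | j | k, hi⟩ := P.part_cover x (hV ▸ hx)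
    exacts [Or.inl ⟨i, hi⟩, Or.inr (Or.inl ⟨j, hi⟩), Or.inr (Or.inr ⟨k, hi⟩)]
  refine ⟨fun x hx => ?_, fun x hx => ?_, fun x hx => ?_⟩
  · rcases hcov x (by simp [hx]) with h | ⟨j, h⟩ | ⟨k, h⟩
    · exact h
    · exact absurd (hPB j h) (Finset.disjoint_left.mp hAB hx)
    · exact absurd (hPC k h) (Finset.disjoint_left.mp hAC hx)
  · rcases hcov x (by simp [hx]) with ⟨i, h⟩ | h | ⟨k, h⟩
    · exact absurd hx (Finset.disjoint_left.mp hAB (hPA i h))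
    · exact h
    · exact absurd (hPC k h) (Finset.disjoint_left.mp hBC hx)
  · rcases hcov x (by simp [hx]) with ⟨i, h⟩ | ⟨j, h⟩ | h
    · exact absurd hx (Finset.disjoint_left.mp hAC (hPA i h))
    · exact absurd hx (Finset.disjoint_left.mp hBC (hPB j h))
    · exact h

lemma Decomp.sum_card_part_comp {V : Finset ℕ} {ι κ : Type} {t : ℕ} (P : Decomp V ι κ)
    {e : Fin t → ι} (he : Function.Injective e) {C : Finset ℕ} (hK : ∀ i, P.part (e i) ⊆ C)
    (hC : ∀ x ∈ C, ∃ i, x ∈ P.part (e i)) : ∑ i, ((P.part (e i)).card : ℝ) = C.card := by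
  rw [← P.sum_card_part_eq (K := Finset.univ.image e) (by simpa using hK) (by simpa using hC),
    Finset.sum_image he.injOn]

/-- The density threshold for the pieces of a decomposition with `l` pieces per pair of parts. -/
lemma density_threshold_bounds {q m l : ℝ} (hq0 : 0 < q) (hq1 : q ^ 4 ≤ 1) (hm : 1 ≤ m)
    (hl : 1 ≤ l) :
    5 * l * (q ^ 4 / (5 * (l + 1) ^ 2 * m)) * m ≤ q ^ 4 / l ∧
      q ^ 4 / (5 * (l + 1) ^ 2 * m) ≤ q ^ 4 / l ∧ q ^ 4 / (5 * (l + 1) ^ 2 * m) ≤ 1 := by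
  have hl0 : 0 < l := by linarith
  have hm0 : 0 < m := by linarith
  have h1 : 5 * l * (q ^ 4 / (5 * (l + 1) ^ 2 * m)) * m ≤ q ^ 4 / l := by
    have e : 5 * l * (q ^ 4 / (5 * (l + 1) ^ 2 * m)) * m = q ^ 4 * (l / (l + 1) ^ 2) := by
      field_simp
    rw [e, div_eq_mul_inv (q ^ 4)]
    gcongr
    rw [div_le_iff₀ (by positivity), inv_mul_eq_div, le_div_iff₀ hl0]
    nlinarith
  have h2 : q ^ 4 / (5 * (l + 1) ^ 2 * m) ≤ q ^ 4 / l := by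
    gcongr
    nlinarith [mul_nonneg hl0.le hl0.le, mul_nonneg (sub_nonneg.mpr hm) (sq_nonneg (l + 1))]
  refine ⟨h1, h2, h2.trans ?_⟩
  rw [div_le_one hl0]
  linarith

/-- On a dense piece lying in few irregular triples, the pairs whose color is adjacent to `v` or
those whose color is not adjacent to `v` form a small minority. -/
lemma IsBlowupWith.minority {G : Bigraph} {s q η ρ : ℝ} {N : ℕ} {ι κ : Type} [Fintype κ]
    (hs0 : 0 < s) (hs1 : s ≤ 1 / 2 ^ 50) (hms : G.right.card * s ≤ 1) (hq0 : 0 < q)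
    (hqs : q ≤ s) (hδs : q ^ 4 ≤ s ^ 33) (hρ0 : 0 < ρ) (hρ1 : ρ ≤ 1)
    (hρκ : 5 * Fintype.card κ * ρ * G.right.card ≤ q ^ 4 / Fintype.card κ)
    (hη : η ≤ (ρ ^ 4 * s ^ 4 / 16) ^ 4) {Γ : BipColored G.left} {Cfam : ℕ → Finset ℕ}
    {H : ThreeGraph} (hH : IsBlowupWith G N Γ Cfam H) (hN : 0 < N) (P : Decomp H.verts ι κ)
    {i j : ι} {α : κ} (hE : P.pairs i j α ⊆ Γ.A ×ˢ Γ.B) {K : Finset ι}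
    (hK : ∀ k ∈ K, P.part k ⊆ G.right.biUnion Cfam)
    (hcov : ∀ z ∈ G.right.biUnion Cfam, ∃ k ∈ K, z ∈ P.part k)
    (hE0 : 0 < ((P.pairs i j α).card : ℝ))
    (hdense : q ^ 4 / Fintype.card κ * (P.part i).card * (P.part j).card ≤ (P.pairs i j α).card)
    (hρd : ρ ≤ (P.pairBG i j α).density)
    (hgood : (((P.pairs i j α ×ˢ G.right.biUnion Cfam).filter
      fun p => ¬ P.RegTriple H.obar (q ^ 4) η (p.1.1, p.1.2, p.2)).card : ℝ) ≤
        q ^ 2 * (P.pairs i j α).card * (G.right.biUnion Cfam).card)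
    {v : ℕ} (hv : v ∈ G.right) :
    (((P.pairs i j α).filter (Γ.ColorAdj v)).card : ℝ) ≤ s ^ 3 * (P.pairs i j α).card ∨
    (((P.pairs i j α).filter fun p => ¬ Γ.ColorAdj v p).card : ℝ) ≤
      s ^ 3 * (P.pairs i j α).card := by
  have hm0 : (0 : ℝ) < G.right.card := Nat.cast_pos.mpr (Finset.card_pos.mpr ⟨v, hv⟩)
  have hDC : Cfam v ⊆ G.right.biUnion Cfam := Finset.subset_biUnion_of_mem Cfam hv
  have hDcard : ((G.right.biUnion Cfam).card : ℝ) = G.right.card * (Cfam v).card := by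
    rw [hH.card_biUnion, hH.1 v hv, Nat.cast_mul]
  have hD0 : 0 < ((Cfam v).card : ℝ) := by
    rw [hH.1 v hv]
    exact Nat.cast_pos.mpr hN
  have hbad : (((P.pairs i j α ×ˢ Cfam v).filter
      fun p => ¬ P.RegTriple H.obar (q ^ 4) η (p.1.1, p.1.2, p.2)).card : ℝ) ≤
        1 / 4 * ((P.pairs i j α).card * (Cfam v).card) := by
    refine le_trans (Nat.cast_le.mpr (Finset.card_le_card (Finset.filter_subset_filter _
      (Finset.product_subset_product_right hDC)))) (hgood.trans ?_)
    rw [hDcard]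
    have h2 : q ^ 2 * G.right.card ≤ 1 / 4 := by
      have hs2 : s ≤ 1 / 4 := hs1.trans (by norm_num)
      calc q ^ 2 * (G.right.card : ℝ) = q * (G.right.card * q) := by ring
        _ ≤ 1 / 4 * 1 := by
          gcongr
          · exact hqs.trans hs2
          · exact le_trans (by gcongr) hms
        _ = 1 / 4 := by norm_num
    calc q ^ 2 * ((P.pairs i j α).card : ℝ) * (G.right.card * (Cfam v).card)
        = q ^ 2 * G.right.card * ((P.pairs i j α).card * (Cfam v).card) := by ring
      _ ≤ _ := by gcongr
  obtain ⟨k, β, γ, hdev, hβ, hγ, hk⟩ := P.exists_regular_triad hK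
    (fun z hz => hcov z (hDC hz)) hm0 hDcard hD0 hE0 hdense hρ0.le hρκ hbad
  exact Triad.minority (G := P.triadOf i j k α β γ)
    hs0 hs1 hms hρ0 hρ1 rfl (by positivity) hδs hη hdev hρd hβ hγ
    (Wp := Cfam v ∩ P.part k) Finset.inter_subset_right hk (Γ.ColorAdj v)
    fun x y z hxy hz => hH.mem_obar_iff hv (hE hxy) (Finset.mem_inter.mp hz).1

/-- A family of minority statements yields a simultaneous correlation. -/
lemma BipColored.exists_correlation {G : Bigraph} (Γ : BipColored G.left) {E : Finset (ℕ × ℕ)}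
    (hE : E ⊆ Γ.A ×ˢ Γ.B) {τ : ℝ} (hmin : ∀ v ∈ G.right,
      ((E.filter (Γ.ColorAdj v)).card : ℝ) ≤ τ * E.card ∨
      ((E.filter fun p => ¬ Γ.ColorAdj v p).card : ℝ) ≤ τ * E.card) :
    ∃ f : ℕ → Bool, (1 - G.right.card * τ) * E.card ≤
      ((E.filter fun p => ∀ v ∈ G.right,
        ∃ u ∈ (if f v then G.leftNbhd v else G.left \ G.leftNbhd v),
          p ∈ (Γ.colorBG u).edges).card : ℝ) := by
  refine ⟨fun v => decide (((E.filter fun p => ¬ Γ.ColorAdj v p).card : ℝ) ≤ τ * E.card),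
    card_filter_forall_ge E G.right _ fun v hv => ?_⟩
  by_cases hc : ((E.filter fun p => ¬ Γ.ColorAdj v p).card : ℝ) ≤ τ * E.card
  · simp only [hc, decide_true, if_true]
    refine le_trans (Nat.cast_le.mpr (Finset.card_le_card fun p hp => ?_)) hc
    exact Finset.mem_filter.mpr (Finset.mem_filter.mp hp)
  · simp only [hc, decide_false]
    refine le_trans (Nat.cast_le.mpr (Finset.card_le_card ?_)) ((hmin v hv).resolve_right hc)
    intro p hp
    obtain ⟨hp, hn⟩ := Finset.mem_filter.mp hp
    refine Finset.mem_filter.mpr ⟨hp, ?_⟩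
    by_contra hna
    exact hn (by simpa using Γ.exists_color_of_not_colorAdj (hE hp) hna)

/-- Regular decompositions of a blowup correlate with the coloring, with all parameters expressed
through `s` and `q`. -/
lemma blowup_correlates {G : Bigraph} {s q η : ℝ} {n t ℓ : ℕ} (hm : 0 < G.right.card)
    (hs0 : 0 < s) (hs1 : s ≤ 1 / 2 ^ 50) (hms : G.right.card * s ≤ 1) (hq0 : 0 < q)
    (hqs : q ≤ s ^ 9) (hn : 1 ≤ n) (hdvd : G.right.card ∣ n) (ht : 1 ≤ t) (hℓ : 1 ≤ ℓ)
    (hη : η ≤ ((q ^ 4 / (5 * (ℓ + 1 : ℝ) ^ 2 * G.right.card)) ^ 4 * s ^ 4 / 16) ^ 4)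
    {Γ : BipColored G.left} (hA : Γ.A.card = n) (hB : Γ.B.card = n) {Cfam : ℕ → Finset ℕ}
    {H : ThreeGraph} (hH : IsBlowupWith G (n / G.right.card) Γ Cfam H)
    (P : Decomp H.verts (Fin t ⊕ Fin t ⊕ Fin t) (Fin ℓ)) (hreg : P.regWrt H.obar (q ^ 4) η)
    (hPA : ∀ i : Fin t, P.part (Sum.inl i) ⊆ Γ.A)
    (hPB : ∀ i : Fin t, P.part (Sum.inr (Sum.inl i)) ⊆ Γ.B)
    (hPC : ∀ i : Fin t, P.part (Sum.inr (Sum.inr i)) ⊆ G.right.biUnion Cfam) :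
    ∃ i j : Fin t, ∃ Zset : Finset (Fin ℓ),
      q ^ 4 * n / (3 * t) ≤ ((P.part (Sum.inl i)).card : ℝ) ∧
      q ^ 4 * n / (3 * t) ≤ ((P.part (Sum.inr (Sum.inl j))).card : ℝ) ∧
      (1 - q) * ((P.part (Sum.inl i)).card * (P.part (Sum.inr (Sum.inl j))).card) ≤
        ∑ α ∈ Zset, ((P.pairs (Sum.inl i) (Sum.inr (Sum.inl j)) α).card : ℝ) ∧
      ∀ α ∈ Zset, ∃ f : ℕ → Bool,
        (1 - s ^ 2) * ((P.pairs (Sum.inl i) (Sum.inr (Sum.inl j)) α).card : ℝ) ≤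
          (((P.pairs (Sum.inl i) (Sum.inr (Sum.inl j)) α).filter
            fun p => ∀ v ∈ G.right, ∃ u ∈ (if f v then G.leftNbhd v else G.left \ G.leftNbhd v),
              p ∈ (Γ.colorBG u).edges).card : ℝ) := by
  have hmm : (1 : ℝ) ≤ G.right.card := Nat.one_le_cast.mpr hm
  have hn0 : (0 : ℝ) < n := Nat.cast_pos.mpr hn
  have ht0 : (0 : ℝ) < t := Nat.cast_pos.mpr ht
  have hℓ1 : (1 : ℝ) ≤ ℓ := Nat.one_le_cast.mpr hℓ
  have hℓ0 : (0 : ℝ) < ℓ := by linarith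
  have : Nonempty (Fin ℓ) := ⟨⟨0, hℓ⟩⟩
  have hs1' : s ≤ 1 / 1000 := hs1.trans (by norm_num)
  have hsle1 : s ≤ 1 := by linarith
  have hqs1 : q ≤ s := hqs.trans (pow_le_of_le_one hs0.le hsle1 (by norm_num))
  have hq1 : q ≤ 1 / 1000 := by linarith
  have hδ1 : q ^ 4 ≤ 1 / 4 := by
    linarith [pow_le_of_le_one hq0.le (by linarith) (by norm_num : 4 ≠ 0)]
  have hδs : q ^ 4 ≤ s ^ 33 := by
    calc q ^ 4 ≤ (s ^ 9) ^ 4 := by gcongr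
      _ = s ^ 36 := by ring
      _ ≤ s ^ 33 := pow_le_pow_of_le_one hs0.le hsle1 (by norm_num)
  have hCsub : G.right.biUnion Cfam ⊆ H.verts := by
    rw [hH.2.2.2.1]
    exact Finset.subset_union_right
  have hCcard : (G.right.biUnion Cfam).card = n := by
    rw [hH.card_biUnion, Nat.mul_div_cancel' hdvd]
  have hVcard : (H.verts.card : ℝ) = 3 * n := by
    rw [hH.card_verts, Nat.mul_div_cancel' hdvd, hA, hB]
    push_cast
    ring
  have hCA := Finset.disjoint_union_left.mp hH.disjoint_biUnion
  obtain ⟨hcovA, hcovB, hcovC⟩ := P.tripartite_cover hH.2.2.2.1 Γ.disjAB hCA.1 hCA.2 hPA hPB hPC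
  have hinl : Function.Injective (fun i : Fin t => (Sum.inl i : Fin t ⊕ Fin t ⊕ Fin t)) :=
    Sum.inl_injective
  have hinr : Function.Injective
      (fun i : Fin t => (Sum.inr (Sum.inl i) : Fin t ⊕ Fin t ⊕ Fin t)) :=
    Sum.inr_injective.comp Sum.inl_injective
  have hirr := P.sum_irregular_le hreg hinl hinr hCsub
  rw [hVcard] at hirr
  have hsumA := P.sum_card_part_comp hinl hPA hcovA
  have hsumB := P.sum_card_part_comp hinr hPB hcovB
  rw [hA] at hsumA
  rw [hB] at hsumB
  obtain ⟨i, j, hi, hj, hij⟩ := exists_large_pair ht hn0 (by positivity : 0 < q ^ 4) hδ1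
    (fun _ _ => Nat.cast_nonneg _) hsumA hsumB (hirr.trans (le_of_eq (by ring)))
  have hX0 : (0 : ℝ) < (P.part (Sum.inl i)).card := lt_of_lt_of_le (by positivity) hi
  have hY0 : (0 : ℝ) < (P.part (Sum.inr (Sum.inl j))).card := lt_of_lt_of_le (by positivity) hj
  refine ⟨i, j, _, hi, hj, sum_dense_good_ge hn0 hq0 (by linarith) (by positivity)
    (fun _ => Nat.cast_nonneg _) (P.sum_card_pairs_eq _ _)
    ((P.sum_irregular_pairs_le _ _ _ _).trans hij), ?_⟩
  intro α hα
  obtain ⟨-, hdense, hgood⟩ := Finset.mem_filter.mp hα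
  have hEAB : P.pairs (Sum.inl i) (Sum.inr (Sum.inl j)) α ⊆ Γ.A ×ˢ Γ.B :=
    (P.pairs_sub _ _ _).trans (Finset.product_subset_product (hPA i) (hPB j))
  obtain ⟨hρℓ, hρle, hρ1⟩ := density_threshold_bounds hq0 (by linarith) hmm hℓ1
  have hκ : (Fintype.card (Fin ℓ) : ℝ) = ℓ := by rw [Fintype.card_fin]
  have hE0 : 0 < ((P.pairs (Sum.inl i) (Sum.inr (Sum.inl j)) α).card : ℝ) :=
    lt_of_lt_of_le (by rw [hκ]; positivity) hdense
  have hdensity : q ^ 4 / (5 * (ℓ + 1 : ℝ) ^ 2 * G.right.card) ≤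
      (P.pairBG (Sum.inl i) (Sum.inr (Sum.inl j)) α).density := by
    refine hρle.trans (le_of_mul_le_mul_right ?_ (mul_pos hX0 hY0))
    refine (hκ ▸ hdense).trans (le_of_eq ?_)
    rw [P.card_pairs_eq, mul_assoc]
  obtain ⟨f, hf⟩ := Γ.exists_correlation hEAB fun v hv =>
    hH.minority hs0 hs1 hms hq0 hqs1 hδs (by positivity) hρ1 (by rw [hκ]; exact hρℓ) hη
      (Nat.div_pos (Nat.le_of_dvd hn hdvd) hm) P hEAB
      (K := Finset.univ.image fun k : Fin t => Sum.inr (Sum.inr k)) (by simpa using hPC)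
      (by simpa using hcovC) hE0 (by rw [mul_assoc]; exact hdense) hdensity
      (by rw [hCcard]; exact hgood) hv
  refine ⟨f, le_trans ?_ hf⟩
  gcongr
  calc G.right.card * s ^ 3 = (G.right.card * s) * s ^ 2 := by ring
    _ ≤ 1 * s ^ 2 := by gcongr
    _ = s ^ 2 := one_mul _

/-- Lemma 5.8: regular decompositions of blowups of irreducible bigraphs correlate
with the coloring. -/
theorem stmt_14 :
    ∃ D eStar : ℝ, 0 < D ∧ 0 < eStar ∧
      ∀ G : Bigraph, G.Irreducible →
        ∀ ε₁ : ℝ, 0 < ε₁ → ε₁ < (G.right.card : ℝ) ^ (-D) → ε₁ < eStar ^ D →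
          ∃ ε₂Star : ℕ → ℝ, (∀ x, 0 < ε₂Star x ∧ ε₂Star x < 1) ∧
            ∀ t : ℕ, 1 ≤ t →
              ∀ ε₂ : ℕ → ℝ, (∀ x, 0 < ε₂ x ∧ ε₂ x < 1) → (∀ x, ε₂ x < ε₂Star x) →
                ∃ ε : ℝ, 0 < ε ∧ ∃ n₀ : ℕ, ∀ n : ℕ, n₀ ≤ n → G.right.card ∣ n →
                  ∀ Γ : BipColored G.left, Γ.A.card = n → Γ.B.card = n →
                    (∀ u ∈ G.left, (Γ.colorBG u).EpsRegular ε ∧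
                      |(Γ.colorBG u).density - (G.left.card : ℝ)⁻¹| ≤ ε) →
                    ∀ (Cfam : ℕ → Finset ℕ) (H : ThreeGraph),
                      IsBlowupWith G (n / G.right.card) Γ Cfam H →
                      ∀ ℓ : ℕ, 1 ≤ ℓ →
                        ∀ P : Decomp H.verts (Fin t ⊕ Fin t ⊕ Fin t) (Fin ℓ),
                          P.isReg (ε₁ ^ D) ((ε₂ ℓ) ^ D) →
                          P.regWrt H.obar (ε₁ ^ D) ((ε₂ ℓ) ^ D) →
                          (∀ i : Fin t, P.part (Sum.inl i) ⊆ Γ.A) →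
                          (∀ i : Fin t, P.part (Sum.inr (Sum.inl i)) ⊆ Γ.B) →
                          (∀ i : Fin t,
                            P.part (Sum.inr (Sum.inr i)) ⊆ G.right.biUnion Cfam) →
                          ∃ i j : Fin t, ∃ Zset : Finset (Fin ℓ),
                            ∃ Cgood : Fin ℓ → Finset ℕ,
                            (∀ α, Cgood α ⊆ G.right) ∧
                            ε₁ ^ D * (Γ.A.card : ℝ) / (3 * t) ≤
                              ((P.part (Sum.inl i)).card : ℝ) ∧
                            ε₁ ^ D * (Γ.B.card : ℝ) / (3 * t) ≤
                              ((P.part (Sum.inr (Sum.inl j))).card : ℝ) ∧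
                            (1 - ε₁ ^ (D / 4)) * ((P.part (Sum.inl i)).card : ℝ) *
                                ((P.part (Sum.inr (Sum.inl j))).card : ℝ) ≤
                              ((Zset.biUnion fun α =>
                                P.pairs (Sum.inl i) (Sum.inr (Sum.inl j)) α).card : ℝ) ∧
                            (∀ α ∈ Zset,
                              (1 - 3 * ε₁ ^ (D / 8)) * (G.right.card : ℝ) ≤
                                ((Cgood α).card : ℝ)) ∧
                            (∀ α ∈ Zset, ∃ f : ℕ → Bool,
                              (1 - ε₁ ^ ((1 : ℝ) / 32)) *
                                ((P.pairs (Sum.inl i) (Sum.inr (Sum.inl j)) α).card : ℝ) ≤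
                              (((P.pairs (Sum.inl i) (Sum.inr (Sum.inl j)) α).filter
                                fun p => ∀ v ∈ Cgood α,
                                  ∃ u ∈ (if f v then G.leftNbhd v
                                    else G.left \ G.leftNbhd v),
                                    p ∈ (Γ.colorBG u).edges).card : ℝ)) := by
  refine ⟨64, 1 / 2 ^ 50, by norm_num, by norm_num, ?_⟩
  intro G _ ε₁ hε0 hεm hεe
  have hm : 0 < G.right.card := by
    rcases Nat.eq_zero_or_pos G.right.card with h | h
    · rw [h, Nat.cast_zero, Real.zero_rpow (by norm_num)] at hεm
      linarith
    · exact h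
  have hm0 : (0 : ℝ) < G.right.card := by exact_mod_cast hm
  have hm1 : (1 : ℝ) ≤ G.right.card := by exact_mod_cast hm
  obtain ⟨s, hs0, rfl⟩ : ∃ s : ℝ, 0 < s ∧ s ^ 64 = ε₁ :=
    ⟨ε₁ ^ ((64 : ℕ) : ℝ)⁻¹, Real.rpow_pos_of_pos hε0 _,
      Real.rpow_inv_natCast_pow hε0.le (by norm_num)⟩
  have hpow : ∀ (k : ℕ) (r : ℝ), 64 * r = k → (s ^ 64) ^ r = s ^ k := by
    intro k r h
    rw [← Real.rpow_natCast s 64, ← Real.rpow_mul hs0.le, ← Real.rpow_natCast s k]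
    congr 1
  have hs1 : s ≤ 1 / 2 ^ 50 := by
    have h : s ^ 64 < (1 / 2 ^ 50) ^ 64 := by
      rw [← Real.rpow_natCast (1 / 2 ^ 50) 64]
      exact_mod_cast hεe
    exact (lt_of_pow_lt_pow_left₀ 64 (by positivity) h).le
  have hsle1 : s ≤ 1 := hs1.trans (by norm_num)
  have hms : G.right.card * s ≤ 1 := by
    have h : s ^ 64 < ((G.right.card : ℝ)⁻¹) ^ 64 := by
      rw [Real.rpow_neg hm0.le] at hεm
      rw [inv_pow, ← Real.rpow_natCast _ 64]
      exact_mod_cast hεm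
    have h2 := (lt_of_pow_lt_pow_left₀ 64 (by positivity) h).le
    calc G.right.card * s ≤ G.right.card * (G.right.card : ℝ)⁻¹ := by gcongr
      _ = 1 := mul_inv_cancel₀ hm0.ne'
  set q := s ^ 1024 with hq
  have hq0 : 0 < q := by positivity
  have hqs : q ≤ s ^ 9 := pow_le_pow_of_le_one hs0.le hsle1 (by norm_num)
  have hD : (s ^ 64) ^ (64 : ℝ) = q ^ 4 := by
    rw [hpow 4096 64 (by norm_num), hq, ← pow_mul]
  have hD4 : (s ^ 64) ^ ((64 : ℝ) / 4) = q := hpow 1024 _ (by norm_num)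
  have h32 : (s ^ 64) ^ ((1 : ℝ) / 32) = s ^ 2 := hpow 2 _ (by norm_num)
  refine ⟨fun ℓ => ((q ^ 4 / (5 * (ℓ + 1 : ℝ) ^ 2 * G.right.card)) ^ 4 * s ^ 4 / 16) ^ 4,
    fun x => ⟨by positivity, ?_⟩, ?_⟩
  · have hq1 : q ^ 4 ≤ 1 := pow_le_one₀ hq0.le (hqs.trans (pow_le_one₀ hs0.le hsle1))
    have h1 : q ^ 4 / (5 * (x + 1 : ℝ) ^ 2 * G.right.card) ≤ 1 := by
      refine (div_le_one (by positivity)).mpr (hq1.trans ?_)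
      have h2 : (1 : ℝ) ≤ x + 1 := by linarith [(Nat.cast_nonneg x : (0 : ℝ) ≤ x)]
      have h3 : (1 : ℝ) ≤ (x + 1 : ℝ) ^ 2 := one_le_pow₀ h2
      nlinarith
    refine pow_lt_one₀ (by positivity) ?_ (by norm_num)
    have h2 : (q ^ 4 / (5 * (x + 1 : ℝ) ^ 2 * G.right.card)) ^ 4 * s ^ 4 ≤ 1 :=
      mul_le_one₀ (pow_le_one₀ (by positivity) h1) (by positivity) (pow_le_one₀ hs0.le hsle1)
    linarith
  intro t ht ε₂ hε₂ hε₂lt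
  refine ⟨1, one_pos, 1, ?_⟩
  intro n hn hdvd Γ hA hB _ Cfam H hH ℓ hℓ P _ hreg hPA hPB hPC
  rw [hD] at hreg
  have hη : ε₂ ℓ ^ (64 : ℝ) ≤
      ((q ^ 4 / (5 * (ℓ + 1 : ℝ) ^ 2 * G.right.card)) ^ 4 * s ^ 4 / 16) ^ 4 := by
    refine le_trans ?_ (hε₂lt ℓ).le
    calc ε₂ ℓ ^ (64 : ℝ) ≤ ε₂ ℓ ^ (1 : ℝ) :=
          Real.rpow_le_rpow_of_exponent_ge (hε₂ ℓ).1 (hε₂ ℓ).2.le (by norm_num)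
      _ = ε₂ ℓ := Real.rpow_one _
  obtain ⟨i, j, Zset, h1, h2, h3, h4⟩ := blowup_correlates hm hs0 hs1 hms hq0 hqs hn hdvd ht hℓ hη
    hA hB hH P hreg hPA hPB hPC
  refine ⟨i, j, Zset, fun _ => G.right, fun _ => subset_rfl, ?_, ?_, ?_, ?_, ?_⟩
  · rw [hD, hA]; exact h1
  · rw [hD, hB]; exact h2
  · rw [hD4, Finset.card_biUnion fun α _ β _ h => P.pairs_disj _ _ α β h, mul_assoc]
    push_cast
    exact h3
  · intro α _
    have : 0 ≤ (s ^ 64) ^ ((64 : ℝ) / 8) := by positivity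
    exact mul_le_of_le_one_left (Nat.cast_nonneg _) (by linarith)
  · rw [h32]
    exact h4
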